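/- arXiv:2204.07345 — 2 statements merged into one kernel-verified Lean document; each statement's English description precedes it below -/
import Mathlib

section
/- Suppose n = p_1 p_2 ⋯ p_k, where the p_i are primes (not necessarily distinct), and for 1 ≤ i ≤ k let b_i be an integer coprime to p_i. Then the sequence S = (b_1, p_1 b_2, p_1 p_2 b_3, …, p_1 p_2 ⋯ p_{k−1} b_k, 0, …, 0) in Z_n, where 0 occurs n − 1 times, is a U(n)-extremal sequence for the Gao constant; in particular S has length n − 1 + Ω(n) and has no U(n)-weighted zero-sum subsequence of length n. -/
open Classical in
/-- The number of terms of the sequence `S` satisfying the predicate `P`. -/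
noncomputable def pcount {α : Type*} (P : α → Prop) (S : List α) : ℕ :=
  S.countP fun x => decide (P x)

/-- `S` is an `A`-weighted zero-sum sequence in `ZMod n`: there are weights
`a i ∈ A` with `∑ a i * x i = 0`. -/
def IsWZSum {n : ℕ} (A : Set (ZMod n)) (S : List (ZMod n)) : Prop :=
  ∃ w : List (ZMod n), w.length = S.length ∧ (∀ a ∈ w, a ∈ A) ∧
    (List.zipWith (· * ·) w S).sum = 0

/-- `S` has an `A`-weighted zero-sum subsequence of length `t ≥ 1`. -/
def HasWZSS {n : ℕ} (A : Set (ZMod n)) (S : List (ZMod n)) (t : ℕ) : Prop :=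
  0 < t ∧ ∃ T : List (ZMod n), T.Sublist S ∧ T.length = t ∧ IsWZSum A T

/-- `S` has a nonempty `A`-weighted zero-sum subsequence. -/
def HasWZS {n : ℕ} (A : Set (ZMod n)) (S : List (ZMod n)) : Prop :=
  ∃ T : List (ZMod n), T.Sublist S ∧ T ≠ [] ∧ IsWZSum A T

/-- The `A`-weighted Davenport constant `D_A(n)`: the least `k > 0` such that every
sequence of length `k` in `ZMod n` has a nonempty `A`-weighted zero-sum subsequence. -/
noncomputable def DavC (n : ℕ) (A : Set (ZMod n)) : ℕ :=
  sInf {k | 0 < k ∧ ∀ S : List (ZMod n), S.length = k → HasWZS A S}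

/-- The `A`-weighted Gao constant `E_A(n)`: the least `k > 0` such that every
sequence of length `k` in `ZMod n` has an `A`-weighted zero-sum subsequence of length `n`. -/
noncomputable def GaoC (n : ℕ) (A : Set (ZMod n)) : ℕ :=
  sInf {k | 0 < k ∧ ∀ S : List (ZMod n), S.length = k → HasWZSS A S n}

/-- The set of units of `ZMod n`. -/
def U (n : ℕ) : Set (ZMod n) := {x | IsUnit x}

/-- An `A`-extremal sequence for the Gao constant: a sequence of length `E_A(n) - 1`
with no `A`-weighted zero-sum subsequence of length `n`. -/
def IsGaoExtremal (n : ℕ) (A : Set (ZMod n)) (S : List (ZMod n)) : Prop :=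
  S.length = GaoC n A - 1 ∧ ¬ HasWZSS A S n

/-- `S` and `T` are `A`-equivalent: there are a unit `c`, weights `a i ∈ A` and a
permutation matching the multiset of terms `c * y j` with the multiset `a i * x i`. -/
def AEquiv {n : ℕ} (A : Set (ZMod n)) (S T : List (ZMod n)) : Prop :=
  ∃ c : ZMod n, IsUnit c ∧ ∃ w : List (ZMod n), w.length = S.length ∧
    (∀ a ∈ w, a ∈ A) ∧ (T.map fun y => c * y).Perm (List.zipWith (· * ·) w S)

open ArithmeticFunction.Omega

/-- There are integer weights prime to `p` whose weighted sum of the terms `x i`, `i ∈ T`,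
is divisible by `p ^ e`. -/
def LocalZeroSum {ι : Type*} (p e : ℕ) (x : ι → ℤ) (T : Finset ι) : Prop :=
  ∃ w : ι → ℤ, (∀ i, ¬ (p : ℤ) ∣ w i) ∧ (p : ℤ) ^ e ∣ ∑ i ∈ T, w i * x i

section Local

variable {ι : Type*} {p : ℕ} {x : ι → ℤ} {T : Finset ι}

lemma localZeroSum_of_forall_dvd (hp : p.Prime) {e : ℕ} (h : ∀ i ∈ T, (p : ℤ) ^ e ∣ x i) :
    LocalZeroSum p e x T :=
  ⟨fun _ => 1, fun _ => (Nat.prime_iff_prime_int.mp hp).not_dvd_one,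
    Finset.dvd_sum fun i hi => (h i hi).mul_left 1⟩

/-- A term of minimal `p`-adic valuation `f` can be used to solve for a zero-sum, as soon as the
weighted sum of the other terms has valuation `f` as well. -/
lemma localZeroSum_of_pivot [DecidableEq ι] (hp : p.Prime) {f : ℕ} (e : ℕ)
    (hdvd : ∀ i ∈ T, (p : ℤ) ^ f ∣ x i)
    {j : ι} (hj : j ∈ T) (hxj : ¬ (p : ℤ) ^ (f + 1) ∣ x j) (w : ι → ℤ)
    (hw : ∀ i, ¬ (p : ℤ) ∣ w i)
    (hsum : ¬ (p : ℤ) ^ (f + 1) ∣ ∑ i ∈ T.erase j, w i * x i) : LocalZeroSum p e x T := by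
  have hpi := Nat.prime_iff_prime_int.mp hp
  obtain ⟨u, hu⟩ := hdvd j hj
  obtain ⟨c, hc⟩ : (p : ℤ) ^ f ∣ ∑ i ∈ T.erase j, w i * x i :=
    Finset.dvd_sum fun i hi => (hdvd i (Finset.mem_of_mem_erase hi)).mul_left _
  have hpu : ¬ (p : ℤ) ∣ u := fun h => hxj (by rw [hu, pow_succ]; exact mul_dvd_mul_left _ h)
  have hpc : ¬ (p : ℤ) ∣ c := fun h => hsum (by rw [hc, pow_succ]; exact mul_dvd_mul_left _ h)
  obtain ⟨a, b, hab⟩ : IsCoprime u ((p : ℤ) ^ (e + 1)) :=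
    ((hpi.coprime_iff_not_dvd.mpr hpu).symm).pow_right
  have hpa : ¬ (p : ℤ) ∣ a := fun h => hpi.not_dvd_one <| by
    rw [← hab]
    exact dvd_add (h.mul_right _) ((dvd_pow_self _ (Nat.succ_ne_zero e)).mul_left _)
  refine ⟨Function.update w j (-c * a), fun i => ?_, ?_⟩
  · by_cases hij : i = j
    · subst hij
      rw [Function.update_self]
      intro h
      rcases hpi.dvd_or_dvd h with h | h
      · exact hpc ((dvd_neg).mp h)
      · exact hpa h
    · rw [Function.update_of_ne hij]
      exact hw i
  · rw [← Finset.add_sum_erase _ _ hj, Function.update_self,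
      Finset.sum_congr rfl (g := fun i => w i * x i), hc, hu]
    · have : -c * a * ((p : ℤ) ^ f * u) + (p : ℤ) ^ f * c = (p : ℤ) ^ e * (p ^ f * c * b * p) := by
        linear_combination (- c * (p : ℤ) ^ f) * hab
      rw [this]
      exact dvd_mul_right _ _
    · intro i hi
      rw [Function.update_of_ne (Finset.ne_of_mem_erase hi)]

lemma localZeroSum_of_two [DecidableEq ι] (hp : p.Prime) (hp2 : p ≠ 2) {f : ℕ} (e : ℕ)
    (hdvd : ∀ i ∈ T, (p : ℤ) ^ f ∣ x i) {i j : ι} (hi : i ∈ T) (hj : j ∈ T) (hij : i ≠ j)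
    (hxi : ¬ (p : ℤ) ^ (f + 1) ∣ x i) (hxj : ¬ (p : ℤ) ^ (f + 1) ∣ x j) :
    LocalZeroSum p e x T := by
  have hpi := Nat.prime_iff_prime_int.mp hp
  have hone : ¬ (p : ℤ) ∣ 1 := hpi.not_dvd_one
  by_cases h1 : (p : ℤ) ^ (f + 1) ∣ ∑ i ∈ T.erase j, x i
  · refine localZeroSum_of_pivot hp e hdvd hj hxj (Function.update (fun _ => 1) i (-1)) ?_ ?_
    · intro l
      by_cases hl : l = i
      · subst hl
        simpa using hone
      · simpa [Function.update_of_ne hl] using hone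
    · intro h2
      have hmem : i ∈ T.erase j := Finset.mem_erase.mpr ⟨hij, hi⟩
      rw [← Finset.add_sum_erase _ _ hmem] at h1 h2
      rw [Function.update_self, Finset.sum_congr rfl (g := x)] at h2
      · have h3 : (p : ℤ) ^ (f + 1) ∣ 2 * x i := by
          have := dvd_sub h1 h2
          ring_nf at this
          ring_nf
          exact this
        have hcop : IsCoprime ((p : ℤ) ^ (f + 1)) 2 := by
          refine IsCoprime.pow_left ?_
          exact_mod_cast Nat.isCoprime_iff_coprime.mpr
            ((Nat.coprime_primes hp Nat.prime_two).mpr hp2)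
        exact hxi (hcop.dvd_of_dvd_mul_left h3)
      · intro l hl
        rw [Function.update_of_ne (Finset.ne_of_mem_erase hl), one_mul]
  · exact localZeroSum_of_pivot hp e hdvd hj hxj (fun _ => 1) (fun _ => hone) (by simpa using h1)

lemma even_sum_iff_even_card_filter_odd (x : ι → ℤ) (T : Finset ι) :
    Even (∑ i ∈ T, x i) ↔ Even (T.filter fun i => Odd (x i)).card := by
  classical
  induction T using Finset.induction_on with
  | empty => simp
  | insert a s ha ih =>
    rw [Finset.sum_insert ha, Finset.filter_insert, Int.even_add, ih]
    split_ifs with h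
    · rw [Finset.card_insert_of_notMem (by simp [ha]), Nat.even_add_one]
      have := Int.not_even_iff_odd.mpr h
      tauto
    · have := Int.not_odd_iff_even.mp h
      tauto

lemma localZeroSum_two_of_even [DecidableEq ι] (e : ℕ)
    (heven : Even (T.filter fun i => Odd (x i)).card)
    (hodd : ∃ j ∈ T, Odd (x j)) : LocalZeroSum 2 e x T := by
  obtain ⟨j, hj, hxj⟩ := hodd
  refine localZeroSum_of_pivot (f := 0) Nat.prime_two e (by simp) hj ?_ (fun _ => 1) ?_ ?_
  · simpa [← even_iff_two_dvd] using hxj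
  · intro _
    norm_num
  · have h : Even (∑ i ∈ T, x i) := by
      exact (even_sum_iff_even_card_filter_odd x T).mpr heven
    rw [← Finset.add_sum_erase _ _ hj] at h
    have := (Int.even_add.mp h).not.mp (by simpa using hxj)
    simpa [← even_iff_two_dvd] using this

/-- Local weights at all primes can be glued to unit weights modulo `n`. -/
lemma exists_unit_weights {n : ℕ} (hn : n ≠ 0)
    (h : ∀ p : ℕ, p.Prime → LocalZeroSum p (n.factorization p) x T) :
    ∃ w : ι → ZMod n, (∀ i, IsUnit (w i)) ∧ ∑ i ∈ T, w i * (x i : ZMod n) = 0 := by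
  have h' : ∀ p : ℕ, ∃ w : ι → ℤ, p.Prime → (∀ i, ¬ (p : ℤ) ∣ w i) ∧
      (p : ℤ) ^ n.factorization p ∣ ∑ i ∈ T, w i * x i := fun p => by
    by_cases hp : p.Prime
    · obtain ⟨w, hw⟩ := h p hp
      exact ⟨w, fun _ => hw⟩
    · exact ⟨fun _ => 0, fun h => absurd h hp⟩
  choose w hw using h'
  have hcrt : ∀ i, ∃ k : ℕ, ∀ p ∈ n.primeFactors,
      (p : ℤ) ^ n.factorization p ∣ (k : ℤ) - w p i := fun i => by
    obtain ⟨k, hk⟩ := Nat.chineseRemainderOfFinset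
      (fun p => (w p i % (p : ℤ) ^ n.factorization p).toNat) (fun p => p ^ n.factorization p)
      n.primeFactors (fun p hp => pow_ne_zero _ (Nat.prime_of_mem_primeFactors hp).ne_zero)
      (fun p hp q hq hpq => Nat.Coprime.pow _ _ ((Nat.coprime_primes
        (Nat.prime_of_mem_primeFactors hp) (Nat.prime_of_mem_primeFactors hq)).mpr hpq))
    refine ⟨k, fun p hp => ?_⟩
    have hpos : ((p : ℤ) ^ n.factorization p) ≠ 0 :=
      pow_ne_zero _ (by exact_mod_cast (Nat.prime_of_mem_primeFactors hp).ne_zero)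
    have := (Int.natCast_modEq_iff.mpr (hk p hp))
    rw [Int.toNat_of_nonneg (Int.emod_nonneg _ hpos)] at this
    push_cast at this
    exact (this.trans (Int.mod_modEq _ _)).symm.dvd
  choose k hk using hcrt
  refine ⟨fun i => (k i : ZMod n), fun i => ?_, ?_⟩
  · rw [ZMod.isUnit_iff_coprime, Nat.coprime_comm]
    refine Nat.Coprime.symm (Nat.coprime_of_dvd fun p hp hpk hpn => ?_)
    have hmem := Nat.mem_primeFactors.mpr ⟨hp, hpn, hn⟩
    have h1 : (p : ℤ) ∣ (k i : ℤ) - w p i :=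
      (dvd_pow_self _ (hp.factorization_pos_of_dvd hn hpn).ne').trans (hk i p hmem)
    exact (hw p hp).1 i ((dvd_sub_right (Int.natCast_dvd_natCast.mpr hpk)).mp h1)
  · have hdvd : (n : ℤ) ∣ ∑ i ∈ T, (k i : ℤ) * x i := by
      rw [Int.natCast_dvd, Nat.dvd_iff_prime_pow_dvd_dvd]
      intro p e hp hpe
      rcases Nat.eq_zero_or_pos e with rfl | he
      · simp
      have hmem := Nat.mem_primeFactors.mpr ⟨hp, (dvd_pow_self p he.ne').trans hpe, hn⟩
      rw [← Int.natCast_dvd]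
      refine dvd_trans (b := (p : ℤ) ^ n.factorization p) ?_ ?_
      · push_cast
        exact pow_dvd_pow _ ((hp.pow_dvd_iff_le_factorization hn).mp hpe)
      · rw [← dvd_sub_left (hw p hp).2, ← Finset.sum_sub_distrib]
        refine Finset.dvd_sum fun i _ => ?_
        rw [← sub_mul]
        exact (hk i p hmem).mul_right _
    have := (ZMod.intCast_zmod_eq_zero_iff_dvd _ n).mpr hdvd
    simpa using this

end Local

section Selection

variable {ι : Type*}

/-- The indices in `S` whose term is not divisible by `d`. -/
def nonMultiples (S : Finset ι) (x : ι → ℤ) (d : ℕ) : Finset ι :=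
  S.filter fun i => ¬ (d : ℤ) ∣ x i

lemma mem_nonMultiples {S : Finset ι} {x : ι → ℤ} {d : ℕ} {i : ι} :
    i ∈ nonMultiples S x d ↔ i ∈ S ∧ ¬ (d : ℤ) ∣ x i :=
  Finset.mem_filter

lemma nonMultiples_mono (S : Finset ι) (x : ι → ℤ) {d d' : ℕ} (h : d ∣ d') :
    nonMultiples S x d ⊆ nonMultiples S x d' := fun i hi => by
  rw [mem_nonMultiples] at hi ⊢
  exact ⟨hi.1, fun h' => hi.2 ((Int.natCast_dvd_natCast.mpr h).trans h')⟩

lemma nonMultiples_lcm [DecidableEq ι] (S : Finset ι) (x : ι → ℤ) (d d' : ℕ) :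
    nonMultiples S x (d.lcm d') ⊆ nonMultiples S x d ∪ nonMultiples S x d' := fun i hi => by
  simp only [Finset.mem_union, mem_nonMultiples] at hi ⊢
  by_contra! h
  refine hi.2 ?_
  rw [Int.natCast_dvd, Nat.lcm_dvd_iff, ← Int.natCast_dvd, ← Int.natCast_dvd]
  exact ⟨h.1 hi.1, h.2 hi.1⟩

/-- Every nontrivial divisor `d` of `n` has more than `Ω d` terms which it does not divide. -/
def HasManyNonMultiples (n : ℕ) (S : Finset ι) (x : ι → ℤ) : Prop :=
  ∀ d, d ∣ n → d ≠ 1 → Ω d + 1 ≤ (nonMultiples S x d).card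

/-- The set `A` contains all terms not divisible by the odd divisor `d` of `n` and has the
critical size `Ω d + 1`. -/
structure IsTight (n : ℕ) (S : Finset ι) (x : ι → ℤ) (A : Finset ι) (d : ℕ) : Prop where
  dvd : d ∣ n
  odd : Odd d
  subset : A ⊆ S
  nonMultiples_subset : nonMultiples S x d ⊆ A
  card_eq : A.card = Ω d + 1

variable {n : ℕ} {S : Finset ι} {x : ι → ℤ}

lemma isTight_singleton {i : ι} (hi : i ∈ S) : IsTight n S x {i} 1 where
  dvd := one_dvd n
  odd := odd_one
  subset := by simpa using hi
  nonMultiples_subset := by simp [nonMultiples]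
  card_eq := by simp

lemma IsTight.union [DecidableEq ι] (hn : n ≠ 0) (hS : HasManyNonMultiples n S x)
    {A B : Finset ι} {d d' : ℕ}
    (hA : IsTight n S x A d) (hB : IsTight n S x B d') (hAB : (A ∩ B).Nonempty) :
    IsTight n S x (A ∪ B) (d.lcm d') := by
  have hd : d ≠ 0 := ne_zero_of_dvd_ne_zero hn hA.dvd
  have hd' : d' ≠ 0 := ne_zero_of_dvd_ne_zero hn hB.dvd
  have hsub : nonMultiples S x (d.lcm d') ⊆ A ∪ B :=
    (nonMultiples_lcm S x d d').trans
      (Finset.union_subset_union hA.nonMultiples_subset hB.nonMultiples_subset)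
  have hlcm : d.lcm d' ∣ n := Nat.lcm_dvd hA.dvd hB.dvd
  have hΩ : Ω (d.gcd d') + Ω (d.lcm d') = Ω d + Ω d' := by
    rw [← ArithmeticFunction.cardFactors_mul (Nat.gcd_ne_zero_left hd) (Nat.lcm_ne_zero hd hd'),
      Nat.gcd_mul_lcm, ArithmeticFunction.cardFactors_mul hd hd']
  have hinter : Ω (d.gcd d') + 1 ≤ (A ∩ B).card := by
    by_cases hg : d.gcd d' = 1
    · simpa [hg] using hAB
    · refine (hS _ ((Nat.gcd_dvd_left d d').trans hA.dvd) hg).trans (Finset.card_le_card ?_)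
      exact Finset.subset_inter
        ((nonMultiples_mono S x (Nat.gcd_dvd_left d d')).trans hA.nonMultiples_subset)
        ((nonMultiples_mono S x (Nat.gcd_dvd_right d d')).trans hB.nonMultiples_subset)
  have hunion : Ω (d.lcm d') + 1 ≤ (A ∪ B).card := by
    by_cases hl : d.lcm d' = 1
    · have : (A ∪ B).Nonempty := hAB.mono (Finset.inter_subset_union)
      simpa [hl] using this.card_pos
    · exact (hS _ hlcm hl).trans (Finset.card_le_card hsub)
  have hcard := Finset.card_union_add_card_inter A B
  exact
    { dvd := hlcm
      odd := Odd.of_dvd_nat (hA.odd.mul hB.odd) (Nat.lcm_dvd_mul d d')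
      subset := Finset.union_subset hA.subset hB.subset
      nonMultiples_subset := hsub
      card_eq := by
        have h1 := hA.card_eq
        have h2 := hB.card_eq
        omega }

/-- The maximal tight sets partition `S`, so one of them meets a set of odd size in an odd number
of points. -/
lemma exists_maximal_isTight [DecidableEq ι] (hn : n ≠ 0) (hS : HasManyNonMultiples n S x)
    {K : Finset ι}
    (hKS : K ⊆ S) (hK : Odd K.card) :
    ∃ A d, IsTight n S x A d ∧ Odd (A ∩ K).card ∧
      ∀ B d', IsTight n S x B d' → A ⊆ B → B = A := by
  classical
  let F := S.powerset.filter fun A => ∃ d, IsTight n S x A d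
  have hF : ∀ {A}, A ∈ F ↔ ∃ d, IsTight n S x A d := fun {A} => by
    simp only [F, Finset.mem_filter, Finset.mem_powerset, and_iff_right_iff_imp]
    rintro ⟨d, h⟩
    exact h.subset
  let M := F.filter fun A => Maximal (· ∈ F) A
  by_contra! hcon
  have hdisj : (M : Set (Finset ι)).PairwiseDisjoint fun A => A ∩ K := by
    intro A hA B hB hne
    simp only [M, Finset.coe_filter, Set.mem_ofPred_eq] at hA hB
    obtain ⟨d, hd⟩ := hF.mp hA.1
    obtain ⟨d', hd'⟩ := hF.mp hB.1
    rw [Function.onFun, Finset.disjoint_left]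
    intro i hiA hiB
    have hU := hF.mpr ⟨_, hd.union hn hS hd'
      ⟨i, Finset.mem_inter.mpr ⟨(Finset.mem_inter.mp hiA).1, (Finset.mem_inter.mp hiB).1⟩⟩⟩
    exact hne ((hA.2.eq_of_ge hU Finset.subset_union_left).symm.trans
      (hB.2.eq_of_ge hU Finset.subset_union_right))
  have hcover : M.biUnion (fun A => A ∩ K) = K := by
    refine Finset.Subset.antisymm
      (Finset.biUnion_subset.mpr fun A _ => Finset.inter_subset_right) fun i hi => ?_
    obtain ⟨A, hiA, hA⟩ := Finset.exists_le_maximal F (hF.mpr ⟨1, isTight_singleton (hKS hi)⟩)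
    exact Finset.mem_biUnion.mpr ⟨A, Finset.mem_filter.mpr ⟨hA.prop, hA⟩,
      Finset.mem_inter.mpr ⟨hiA (Finset.mem_singleton_self i), hi⟩⟩
  have hsum := Finset.card_biUnion hdisj
  rw [hcover] at hsum
  refine Nat.not_even_iff_odd.mpr hK (hsum ▸ Finset.even_sum _ fun A hA => ?_)
  obtain ⟨hAF, hmax⟩ := Finset.mem_filter.mp hA
  obtain ⟨d, hd⟩ := hF.mp hAF
  by_contra hodd
  obtain ⟨B, d', hB, hAB, hne⟩ := hcon A d hd (Nat.not_even_iff_odd.mp hodd)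
  exact hne (hmax.eq_of_ge (hF.mpr ⟨d', hB⟩) hAB)

/-- Removing a suitable set `A` adjusts the parity of the number of terms in `K`, while keeping at
least two terms of minimal valuation at each relevant odd prime. -/
lemma exists_parity_adjustment [DecidableEq ι] (hn : n ≠ 0) (h2 : 2 ∣ n)
    (hS : HasManyNonMultiples n S x)
    {K : Finset ι} (hKS : K ⊆ S) :
    ∃ A d, A ⊆ S ∧ d ∣ n ∧ Odd d ∧ A.card ≤ Ω n ∧ Even (K \ A).card ∧
      (∀ i ∈ S \ A, (d : ℤ) ∣ x i) ∧ (∃ i ∈ S \ A, Odd (x i)) ∧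
      ∀ p : ℕ, p.Prime → p ≠ 2 → p * d ∣ n → 2 ≤ (nonMultiples S x (p * d) \ A).card := by
  have hodd_of : ∀ {A : Finset ι} {d : ℕ}, d ∣ n → Odd d → (∀ i ∈ S \ A, (d : ℤ) ∣ x i) →
      A.card ≤ Ω d + 1 → ∃ i ∈ S \ A, Odd (x i) := by
    intro A d hdn hd hdiv hcard
    have hcop : Nat.Coprime 2 d := Nat.coprime_two_left.mpr hd
    have h2d := hS (2 * d) (hcop.mul_dvd_of_dvd_of_dvd h2 hdn) (by omega)
    rw [ArithmeticFunction.cardFactors_mul two_ne_zero (ne_zero_of_dvd_ne_zero hn hdn),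
      ArithmeticFunction.cardFactors_apply_prime Nat.prime_two] at h2d
    obtain ⟨i, hi, hiA⟩ := Finset.exists_mem_notMem_of_card_lt_card
      (s := A) (t := nonMultiples S x (2 * d)) (by omega)
    rw [mem_nonMultiples] at hi
    have hiSA : i ∈ S \ A := Finset.mem_sdiff.mpr ⟨hi.1, hiA⟩
    refine ⟨i, hiSA, ?_⟩
    by_contra hne
    refine hi.2 ?_
    push_cast
    refine IsCoprime.mul_dvd ?_ (even_iff_two_dvd.mp (Int.not_odd_iff_even.mp hne)) (hdiv i hiSA)
    exact_mod_cast Nat.isCoprime_iff_coprime.mpr hcop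
  by_cases hK : Even K.card
  · refine ⟨∅, 1, by simp, one_dvd n, odd_one, by simp, by simpa using hK, by simp,
      hodd_of (one_dvd n) odd_one (by simp) (by simp), fun p hp _ hpn => ?_⟩
    have := hS (p * 1) hpn (by simpa using hp.ne_one)
    rw [mul_one, ArithmeticFunction.cardFactors_apply_prime hp] at this
    simpa using this
  · obtain ⟨A, d, hA, hAK, hmax⟩ := exists_maximal_isTight hn hS hKS (Nat.not_even_iff_odd.mp hK)
    have hd0 := ne_zero_of_dvd_ne_zero hn hA.dvd
    have hdiv : ∀ i ∈ S \ A, (d : ℤ) ∣ x i := fun i hi => by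
      rw [Finset.mem_sdiff] at hi
      by_contra h
      exact hi.2 (hA.nonMultiples_subset (mem_nonMultiples.mpr ⟨hi.1, h⟩))
    refine ⟨A, d, hA.subset, hA.dvd, hA.odd, ?_, ?_, hdiv,
      hodd_of hA.dvd hA.odd hdiv hA.card_eq.le, fun p hp hp2 hpd => ?_⟩
    · obtain ⟨c, hc⟩ := (Nat.coprime_two_left.mpr hA.odd).mul_dvd_of_dvd_of_dvd h2 hA.dvd
      have hc0 : c ≠ 0 := by rintro rfl; exact hn hc
      rw [hc, ArithmeticFunction.cardFactors_mul (mul_ne_zero two_ne_zero hd0) hc0,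
        ArithmeticFunction.cardFactors_mul two_ne_zero hd0,
        ArithmeticFunction.cardFactors_apply_prime Nat.prime_two, hA.card_eq]
      omega
    · have h := Finset.card_sdiff_add_card_inter K A
      rw [Finset.inter_comm] at h
      rw [← h] at hK
      rw [Nat.even_add] at hK
      have := Nat.not_even_iff_odd.mpr hAK
      tauto
    · by_contra! hlt
      have hΩ : Ω (p * d) = 1 + Ω d := by
        rw [ArithmeticFunction.cardFactors_mul hp.ne_zero hd0,
          ArithmeticFunction.cardFactors_apply_prime hp]
      have hbig := hS (p * d) hpd (fun h => hp.ne_one (Nat.eq_one_of_mul_eq_one_right h))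
      have hle := Finset.card_le_card
        (Finset.subset_union_left (s₁ := nonMultiples S x (p * d)) (s₂ := A))
      have hcard := Finset.card_sdiff_add_card (nonMultiples S x (p * d)) A
      have hAc := hA.card_eq
      have hU : IsTight n S x (nonMultiples S x (p * d) ∪ A) (p * d) :=
        { dvd := hpd
          odd := (hp.odd_of_ne_two hp2).mul hA.odd
          subset := Finset.union_subset (Finset.filter_subset _ _) hA.subset
          nonMultiples_subset := Finset.subset_union_left
          card_eq := by omega }
      have := hU.card_eq
      rw [hmax _ _ hU Finset.subset_union_right] at this
      omega

lemma exists_pairs [DecidableEq ι] {α : Type*} [DecidableEq α] (P : Finset α) (X : α → Finset ι)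
    (h : ∀ p ∈ P, 2 ≤ (X p).card) :
    ∃ W ⊆ P.biUnion X, W.card ≤ 2 * P.card ∧
      ∀ p ∈ P, ∃ i ∈ W, ∃ j ∈ W, i ≠ j ∧ i ∈ X p ∧ j ∈ X p := by
  have h' : ∀ p, ∃ Y ⊆ X p, p ∈ P → Y.card = 2 := fun p => by
    by_cases hp : p ∈ P
    · obtain ⟨Y, hY, hc⟩ := Finset.exists_subset_card_eq (h p hp)
      exact ⟨Y, hY, fun _ => hc⟩
    · exact ⟨∅, by simp, fun h => absurd h hp⟩
  choose Y hYX hY using h'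
  refine ⟨P.biUnion Y, Finset.biUnion_mono fun p _ => hYX p, ?_, fun p hp => ?_⟩
  · rw [mul_comm]
    exact Finset.card_biUnion_le_card_mul _ _ _ fun p hp => (hY p hp).le
  · obtain ⟨i, hi, j, hj, hij⟩ := Finset.one_lt_card.mp (by rw [hY p hp]; norm_num)
    exact ⟨i, Finset.mem_biUnion.mpr ⟨p, hp, hi⟩, j, Finset.mem_biUnion.mpr ⟨p, hp, hj⟩, hij,
      hYX p hi, hYX p hj⟩

end Selection

section Main

lemma four_mul_card_primeFactors_add_cardFactors_le {n : ℕ} (hn : n ≠ 0) :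
    4 * n.primeFactors.card + Ω n ≤ n + 4 := by
  induction n using induction_on_primes with
  | zero => exact absurd rfl hn
  | one => simp
  | prime_mul p a hp ih =>
    have ha : a ≠ 0 := right_ne_zero_of_mul hn
    have ih := ih ha
    have hp2 := hp.two_le
    rw [ArithmeticFunction.cardFactors_mul hp.ne_zero ha,
      ArithmeticFunction.cardFactors_apply_prime hp]
    by_cases hpa : p ∣ a
    · have : (p * a).primeFactors = a.primeFactors := by
        rw [Nat.primeFactors_mul hp.ne_zero ha, hp.primeFactors, Finset.union_eq_right,
          Finset.singleton_subset_iff]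
        exact Nat.mem_primeFactors.mpr ⟨hp, hpa, ha⟩
      rw [this]
      have := Nat.pos_of_ne_zero ha
      nlinarith
    · have hcard : (p * a).primeFactors.card = 1 + a.primeFactors.card := by
        rw [Nat.primeFactors_mul hp.ne_zero ha, hp.primeFactors, Finset.card_union_of_disjoint,
          Finset.card_singleton]
        rw [Finset.disjoint_singleton_left]
        exact fun h => hpa (Nat.dvd_of_mem_primeFactors h)
      rw [hcard]
      rcases Nat.lt_or_ge a 5 with h5 | h5
      · have hprime : ∀ q : ℕ, q.Prime → q.primeFactors.card = 1 ∧ Ω q = 1 := fun q hq =>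
          ⟨by simp [hq.primeFactors], ArithmeticFunction.cardFactors_apply_prime hq⟩
        interval_cases a
        · simp at ha
        · simp
          omega
        · obtain ⟨h1, h2⟩ := hprime 2 Nat.prime_two
          have : p ≠ 2 := by rintro rfl; exact hpa (dvd_refl _)
          omega
        · obtain ⟨h1, h2⟩ := hprime 3 Nat.prime_three
          omega
        · have h1 : (4 : ℕ).primeFactors.card = 1 := by
            rw [show 4 = 2 ^ 2 by norm_num, Nat.primeFactors_pow 2 two_ne_zero,
              (hprime 2 Nat.prime_two).1]
          have h2 : Ω 4 = 2 := by
            rw [show 4 = 2 ^ 2 by norm_num,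
              ArithmeticFunction.cardFactors_apply_prime_pow Nat.prime_two]
          have : p ≠ 2 := by rintro rfl; exact hpa (by norm_num)
          omega
      · nlinarith

lemma localZeroSum_mul {ι : Type*} {d c : ℕ} (hd : d ≠ 0) (hc : c ≠ 0)
    {x y : ι → ℤ} {T : Finset ι}
    (hxy : ∀ i ∈ T, x i = d * y i) {p : ℕ} (h : LocalZeroSum p (c.factorization p) y T) :
    LocalZeroSum p ((d * c).factorization p) x T := by
  obtain ⟨w, hw, hsum⟩ := h
  refine ⟨w, hw, ?_⟩
  have : ∑ i ∈ T, w i * x i = d * ∑ i ∈ T, w i * y i := by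
    rw [Finset.mul_sum]
    exact Finset.sum_congr rfl fun i hi => by rw [hxy i hi]; ring
  rw [this, Nat.factorization_mul hd hc, Finsupp.add_apply, pow_add]
  exact mul_dvd_mul (by exact_mod_cast Nat.ordProj_dvd d p) hsum

variable {ι : Type*} [DecidableEq ι]

lemma localZeroSum_of_two_nonMultiples {n d p : ℕ} (hn : n ≠ 0) (hdn : d ∣ n) (hp : p.Prime)
    (hp2 : p ≠ 2) {x : ι → ℤ} {T : Finset ι} (hdvd : ∀ i ∈ T, (d : ℤ) ∣ x i)
    (htwo : p * d ∣ n → ∃ i ∈ T, ∃ j ∈ T, i ≠ j ∧ ¬ ((p * d : ℕ) : ℤ) ∣ x i ∧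
      ¬ ((p * d : ℕ) : ℤ) ∣ x j) : LocalZeroSum p (n.factorization p) x T := by
  obtain ⟨c, hc⟩ := hdn
  by_cases hpc : p ∣ c
  · obtain ⟨i, hi, j, hj, hij, hxi, hxj⟩ := htwo (by
      rw [hc, mul_comm p d]
      exact mul_dvd_mul_left d hpc)
    have hd0 : d ≠ 0 := by rintro rfl; simp [hc] at hn
    obtain ⟨f, d', hpd', hd⟩ := Nat.exists_eq_pow_mul_and_not_dvd hd0 p hp.ne_one
    have key : ∀ i ∈ T, ¬ ((p * d : ℕ) : ℤ) ∣ x i → ¬ (p : ℤ) ^ (f + 1) ∣ x i := by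
      intro i hi hxi h
      refine hxi ?_
      rw [hd, ← mul_assoc, ← pow_succ']
      push_cast
      refine IsCoprime.mul_dvd ?_ h
        ((Int.natCast_dvd_natCast.mpr (Dvd.intro_left _ hd.symm)).trans (hdvd i hi))
      exact IsCoprime.pow_left
        (Nat.isCoprime_iff_coprime.mpr ((Nat.Prime.coprime_iff_not_dvd hp).mpr hpd'))
    refine localZeroSum_of_two hp hp2 _ (fun i hi => ?_) hi hj hij (key i hi hxi) (key j hj hxj)
    exact dvd_trans (by rw [hd]; push_cast; exact dvd_mul_right _ _) (hdvd i hi)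
  · refine localZeroSum_of_forall_dvd hp fun i hi => dvd_trans ?_ (hdvd i hi)
    have h : p ^ n.factorization p ∣ d * c := hc ▸ Nat.ordProj_dvd n p
    exact_mod_cast (Nat.Coprime.pow_left _
      ((Nat.Prime.coprime_iff_not_dvd hp).mpr hpc)).dvd_of_dvd_mul_right h

/-- For even `n`, terms can be discarded only outside `K`, apart from one parity adjustment. -/
lemma exists_subset_even_inter {n m : ℕ} (hn : n ≠ 0) (h2 : 2 ∣ n) {S : Finset ι} {x : ι → ℤ}
    (hS : HasManyNonMultiples n S x) (hcard : S.card = m + Ω n) {K : Finset ι} (hKS : K ⊆ S)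
    (hlarge : 2 * n.primeFactors.card + Ω n ≤ (S \ K).card + 2)
    (hK : (∀ i ∈ S, Odd (x i) → i ∈ K) ∨ ((∀ i ∈ S \ K, Odd (x i)) ∧ Ω n < (S \ K).card)) :
    ∃ T ⊆ S, T.card = m ∧ Even (T ∩ K).card ∧ (∃ i ∈ T, Odd (x i)) ∧
      ∀ p : ℕ, p.Prime → p ≠ 2 → LocalZeroSum p (n.factorization p) x T := by
  obtain ⟨A, d, hAS, hdn, -, hAcard, heven, hdiv, hodd, htwo⟩ :=
    exists_parity_adjustment hn h2 hS hKS
  obtain ⟨W, hWsub, hWcard, hW⟩ := exists_pairs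
    ((n.primeFactors.erase 2).filter fun p => p * d ∣ n)
    (fun p => nonMultiples S x (p * d) \ A) (fun p hp => by
      simp only [Finset.mem_filter, Finset.mem_erase] at hp
      exact htwo p (Nat.prime_of_mem_primeFactors hp.1.2) hp.1.1 hp.2)
  have hWcard' : W.card + 2 ≤ 2 * n.primeFactors.card := by
    have h1 := Finset.card_filter_le (n.primeFactors.erase 2) fun p => p * d ∣ n
    have h2' := Finset.card_erase_add_one
      (Nat.mem_primeFactors.mpr ⟨Nat.prime_two, h2, hn⟩ : 2 ∈ n.primeFactors)
    omega
  have hWS : W ⊆ S \ A := fun i hi => by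
    obtain ⟨p, -, hip⟩ := Finset.mem_biUnion.mp (hWsub hi)
    rw [Finset.mem_sdiff, mem_nonMultiples] at hip
    exact Finset.mem_sdiff.mpr ⟨hip.1.1, hip.2⟩
  have h1 := Finset.le_card_sdiff A (S \ K)
  have h3 := Finset.le_card_sdiff W ((S \ K) \ A)
  obtain ⟨R, hRsub, hRcard⟩ := Finset.exists_subset_card_eq
    (s := ((S \ K) \ A) \ W) (n := Ω n - A.card) (by omega)
  have hR : ∀ i ∈ R, i ∈ S ∧ i ∉ K ∧ i ∉ A ∧ i ∉ W := fun i hi => by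
    have := hRsub hi
    simp only [Finset.mem_sdiff] at this
    tauto
  have hRS : R ⊆ S \ A := fun i hi => Finset.mem_sdiff.mpr ⟨(hR i hi).1, (hR i hi).2.2.1⟩
  have hTcard : ((S \ A) \ R).card = m := by
    rw [Finset.card_sdiff_of_subset hRS, Finset.card_sdiff_of_subset hAS]
    omega
  have hTS : (S \ A) \ R ⊆ S \ A := Finset.sdiff_subset
  refine ⟨(S \ A) \ R, hTS.trans Finset.sdiff_subset, hTcard, ?_, ?_, fun p hp hp2 => ?_⟩
  · have : ((S \ A) \ R) ∩ K = K \ A := by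
      ext i
      simp only [Finset.mem_inter, Finset.mem_sdiff]
      have := hR i
      have := @hKS i
      tauto
    rwa [this]
  · rcases hK with hK | ⟨hK, hlt⟩
    · obtain ⟨i, hi, hxi⟩ := hodd
      exact ⟨i, Finset.mem_sdiff.mpr ⟨hi, fun hiR =>
        (hR i hiR).2.1 (hK i (Finset.mem_sdiff.mp hi).1 hxi)⟩, hxi⟩
    · obtain ⟨i, hi, hiAR⟩ := Finset.exists_mem_notMem_of_card_lt_card
        (s := A ∪ R) (t := S \ K) (lt_of_le_of_lt (Finset.card_union_le A R) (by omega))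
      rw [Finset.mem_union, not_or] at hiAR
      exact ⟨i, Finset.mem_sdiff.mpr ⟨Finset.mem_sdiff.mpr
        ⟨(Finset.mem_sdiff.mp hi).1, hiAR.1⟩, hiAR.2⟩, hK i hi⟩
  · refine localZeroSum_of_two_nonMultiples hn hdn hp hp2 (fun i hi => hdiv i (hTS hi))
      fun hpd => ?_
    obtain ⟨i, hi, j, hj, hij, hxi, hxj⟩ := hW p (Finset.mem_filter.mpr ⟨Finset.mem_erase.mpr
      ⟨hp2, Nat.mem_primeFactors.mpr ⟨hp, (Dvd.intro _ rfl).trans hpd, hn⟩⟩, hpd⟩)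
    have hmem : ∀ l ∈ W, l ∈ (S \ A) \ R := fun l hl =>
      Finset.mem_sdiff.mpr ⟨hWS hl, fun h => (hR l h).2.2.2 hl⟩
    exact ⟨i, hmem i hi, j, hmem j hj, hij,
      (mem_nonMultiples.mp (Finset.mem_sdiff.mp hxi).1).2,
      (mem_nonMultiples.mp (Finset.mem_sdiff.mp hxj).1).2⟩

lemma exists_localZeroSum_of_odd {n m : ℕ} (hn : n ≠ 0) (h2 : ¬ 2 ∣ n) (hm : 0 < m) (hnm : n ∣ m)
    {S : Finset ι} {x : ι → ℤ} (hS : HasManyNonMultiples n S x) (hcard : S.card = m + Ω n) :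
    ∃ T ⊆ S, T.card = m ∧
      ∀ p : ℕ, p.Prime → LocalZeroSum p (n.factorization p) x T := by
  obtain ⟨W, hWsub, hWcard, hW⟩ := exists_pairs n.primeFactors (fun p => nonMultiples S x p)
    (fun p hp => by
      have hp' := Nat.prime_of_mem_primeFactors hp
      have := hS p (Nat.dvd_of_mem_primeFactors hp) hp'.ne_one
      rwa [ArithmeticFunction.cardFactors_apply_prime hp'] at this)
  have hWS : W ⊆ S := hWsub.trans (Finset.biUnion_subset.mpr fun p _ => Finset.filter_subset _ _)
  have hWm : W.card ≤ m := by
    have h1 := four_mul_card_primeFactors_add_cardFactors_le hn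
    have h3 := Nat.le_of_dvd hm hnm
    rcases Nat.lt_or_ge n.primeFactors.card 2 with h5 | h5
    · rcases Nat.eq_zero_or_pos n.primeFactors.card with h6 | h6
      · omega
      · obtain ⟨p, hp⟩ := Finset.card_pos.mp h6
        have := (Nat.prime_of_mem_primeFactors hp).two_le
        have := Nat.le_of_dvd (Nat.pos_of_ne_zero hn) (Nat.dvd_of_mem_primeFactors hp)
        omega
    · omega
  obtain ⟨T, hWT, hTS, hT⟩ := Finset.exists_subsuperset_card_eq hWS hWm (by omega)
  refine ⟨T, hTS, hT, fun p hp => ?_⟩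
  by_cases hpn : p ∣ n
  · refine localZeroSum_of_two_nonMultiples hn (one_dvd n) hp (by rintro rfl; exact h2 hpn)
      (by simp) fun _ => ?_
    obtain ⟨i, hi, j, hj, hij, hxi, hxj⟩ := hW p (Nat.mem_primeFactors.mpr ⟨hp, hpn, hn⟩)
    rw [mul_one]
    exact ⟨i, hWT hi, j, hWT hj, hij, (mem_nonMultiples.mp hxi).2, (mem_nonMultiples.mp hxj).2⟩
  · refine localZeroSum_of_forall_dvd hp ?_
    simp [Nat.factorization_eq_zero_of_not_dvd hpn]

lemma exists_localZeroSum_of_even {n m : ℕ} (hn : n ≠ 0) (h2 : 2 ∣ n) (hm : 0 < m) (hnm : n ∣ m)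
    {S : Finset ι} {x : ι → ℤ} (hS : HasManyNonMultiples n S x) (hcard : S.card = m + Ω n) :
    ∃ T ⊆ S, T.card = m ∧
      ∀ p : ℕ, p.Prime → LocalZeroSum p (n.factorization p) x T := by
  have h1 := four_mul_card_primeFactors_add_cardFactors_le hn
  have h3 := Nat.le_of_dvd hm hnm
  have hω : 0 < n.primeFactors.card :=
    Finset.card_pos.mpr ⟨2, Nat.mem_primeFactors.mpr ⟨Nat.prime_two, h2, hn⟩⟩
  have hsplit := Finset.card_filter_add_card_filter_not (s := S) fun i => Odd (x i)
  have finish : ∀ T : Finset ι, Even (T.filter fun i => Odd (x i)).card → (∃ i ∈ T, Odd (x i)) →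
      (∀ p : ℕ, p.Prime → p ≠ 2 → LocalZeroSum p (n.factorization p) x T) →
      ∀ p : ℕ, p.Prime → LocalZeroSum p (n.factorization p) x T := by
    intro T heven hodd hloc p hp
    by_cases hp2 : p = 2
    · subst hp2
      exact localZeroSum_two_of_even _ heven hodd
    · exact hloc p hp hp2
  rcases le_or_gt (S.filter fun i => Odd (x i)).card (S.filter fun i => ¬ Odd (x i)).card
    with hle | hlt
  · have hM : S \ S.filter (fun i => Odd (x i)) = S.filter fun i => ¬ Odd (x i) :=
      (Finset.filter_not _ _).symm
    obtain ⟨T, hTS, hT, heven, hodd, hloc⟩ := exists_subset_even_inter hn h2 hS hcard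
      (Finset.filter_subset (fun i => Odd (x i)) S) (by rw [hM]; omega)
      (Or.inl fun i hi hxi => Finset.mem_filter.mpr ⟨hi, hxi⟩)
    refine ⟨T, hTS, hT, finish T ?_ hodd hloc⟩
    rwa [Finset.inter_filter, Finset.inter_eq_left.mpr hTS] at heven
  · have hM : S \ S.filter (fun i => ¬ Odd (x i)) = S.filter fun i => Odd (x i) := by
      rw [← Finset.filter_not]
      simp
    obtain ⟨T, hTS, hT, heven, hodd, hloc⟩ := exists_subset_even_inter hn h2 hS hcard
      (Finset.filter_subset (fun i => ¬ Odd (x i)) S) (by rw [hM]; omega)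
      (Or.inr ⟨fun i hi => by rw [hM] at hi; exact (Finset.mem_filter.mp hi).2,
        by rw [hM]; omega⟩)
    refine ⟨T, hTS, hT, finish T ?_ hodd hloc⟩
    have hTsplit := Finset.card_filter_add_card_filter_not (s := T) fun i => Odd (x i)
    rw [Finset.inter_filter, Finset.inter_eq_left.mpr hTS] at heven
    have hmeven : Even m := even_iff_two_dvd.mpr (h2.trans hnm)
    rw [← hT, ← hTsplit, Nat.even_add] at hmeven
    exact hmeven.mpr heven

theorem exists_localZeroSum_subset (n : ℕ) (hn : n ≠ 0) {m : ℕ} (hm : 0 < m) (hnm : n ∣ m)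
    (S : Finset ι) (x : ι → ℤ) (hcard : m + Ω n ≤ S.card) :
    ∃ T ⊆ S, T.card = m ∧ ∀ p : ℕ, p.Prime → LocalZeroSum p (n.factorization p) x T := by
  induction n using Nat.strong_induction_on generalizing S x with
  | _ n ih =>
  obtain ⟨S', hS', hcard'⟩ := Finset.exists_subset_card_eq hcard
  suffices h : ∃ T ⊆ S', T.card = m ∧
      ∀ p : ℕ, p.Prime → LocalZeroSum p (n.factorization p) x T by
    obtain ⟨T, hT, h⟩ := h
    exact ⟨T, hT.trans hS', h⟩
  by_cases hS : HasManyNonMultiples n S' x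
  · by_cases h2 : 2 ∣ n
    · exact exists_localZeroSum_of_even hn h2 hm hnm hS hcard'
    · exact exists_localZeroSum_of_odd hn h2 hm hnm hS hcard'
  · unfold HasManyNonMultiples at hS
    push Not at hS
    obtain ⟨d, ⟨c, rfl⟩, hd1, hlt⟩ := hS
    have hd : d ≠ 0 := left_ne_zero_of_mul hn
    have hc : c ≠ 0 := right_ne_zero_of_mul hn
    have hcn : c < d * c := by
      have : 2 ≤ d := by omega
      nlinarith [Nat.pos_of_ne_zero hc]
    have hsize := Finset.le_card_sdiff (nonMultiples S' x d) S'
    rw [ArithmeticFunction.cardFactors_mul hd hc] at hcard'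
    obtain ⟨T, hTS, hT, hloc⟩ := ih c hcn hc ((Dvd.intro_left d rfl).trans hnm)
      (S' \ nonMultiples S' x d) (fun i => x i / d) (by omega)
    refine ⟨T, hTS.trans Finset.sdiff_subset, hT, fun p hp =>
      localZeroSum_mul hd hc (fun i hi => ?_) (hloc p hp)⟩
    have := hTS hi
    rw [Finset.mem_sdiff, mem_nonMultiples] at this
    exact (Int.mul_ediv_cancel' (by tauto)).symm

end Main

section Gao

/-- Every sequence of length at least `n + Ω n` in `ZMod n` has a `U(n)`-weighted zero-sum
subsequence of length `n`. -/
lemma hasWZSS_units {n : ℕ} (hn : n ≠ 0) (S : List (ZMod n)) (hS : S.length = n + Ω n) :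
    HasWZSS (U n) S n := by
  obtain ⟨x, hx⟩ : ∃ x : Fin S.length → ℤ, ∀ i, (x i : ZMod n) = S.get i := by
    choose f hf using fun a : ZMod n => ZMod.intCast_surjective a
    exact ⟨fun i => f (S.get i), fun i => hf _⟩
  obtain ⟨T, -, hT, hloc⟩ := exists_localZeroSum_subset n hn (Nat.pos_of_ne_zero hn) dvd_rfl
    Finset.univ x (by simp [hS])
  obtain ⟨w, hw, hsum⟩ := exists_unit_weights hn hloc
  let l := (List.finRange S.length).filter fun i => decide (i ∈ T)
  have hnodup : l.Nodup := (List.nodup_finRange _).filter _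
  have hlT : l.toFinset = T := by
    ext i
    simp [l]
  refine ⟨Nat.pos_of_ne_zero hn, l.map S.get, ?_, ?_, l.map w, by simp, ?_, ?_⟩
  · have : (List.finRange S.length).map S.get = S := by simp
    conv_rhs => rw [← this]
    exact List.filter_sublist.map _
  · rw [List.length_map, ← List.toFinset_card_of_nodup hnodup, hlT, hT]
  · intro a ha
    obtain ⟨i, -, rfl⟩ := List.mem_map.mp ha
    exact hw i
  · rw [List.zipWith_map, List.zipWith_self, ← List.sum_toFinset _ hnodup, hlT, ← hsum]
    exact Finset.sum_congr rfl fun i _ => by rw [hx]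

lemma HasWZSS.of_sublist {n t : ℕ} {A : Set (ZMod n)} {S S' : List (ZMod n)}
    (h : HasWZSS A S t) (hS : S.Sublist S') : HasWZSS A S' t :=
  let ⟨ht, T, hT, h'⟩ := h
  ⟨ht, T, hT.trans hS, h'⟩

lemma gaoC_units_eq {n : ℕ} (hn : n ≠ 0) {S : List (ZMod n)} (hS : S.length = n - 1 + Ω n)
    (hzero : ¬ HasWZSS (U n) S n) : GaoC n (U n) = n + Ω n := by
  have hmem : n + Ω n ∈
      {k | 0 < k ∧ ∀ S : List (ZMod n), S.length = k → HasWZSS (U n) S n} :=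
    ⟨by omega, hasWZSS_units hn⟩
  refine le_antisymm (Nat.sInf_le hmem) (le_csInf ⟨_, hmem⟩ fun k hk => ?_)
  by_contra! hlt
  exact hzero ((hk.2 (S.take k) (by rw [List.length_take]; omega)).of_sublist
    (List.take_sublist k S))

lemma dvd_sum_zipWith_mul {R : Type*} [CommSemiring R] {d : R} (w l : List R)
    (h : ∀ a ∈ l, d ∣ a) : d ∣ (List.zipWith (· * ·) w l).sum := by
  refine List.dvd_sum fun a ha => ?_
  obtain ⟨i, hi, rfl⟩ := List.mem_iff_getElem.mp ha
  rw [List.getElem_zipWith]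
  exact (h _ (List.getElem_mem _)).mul_left _

/-- The first term of a subsequence of the initial segment is never cancelled by later ones. -/
lemma not_hasWZSS_star {k n : ℕ} {p : Fin k → ℕ} (hp : ∀ i, (p i).Prime)
    (hn : n = ∏ i, p i) {b : Fin k → ℤ} (hb : ∀ i, IsCoprime (b i) (p i : ℤ)) :
    ¬ HasWZSS (U n) ((List.ofFn fun i : Fin k =>
        (((∏ j ∈ Finset.Iio i, (p j : ℤ)) * b i : ℤ) : ZMod n)) ++
      List.replicate (n - 1) (0 : ZMod n)) n := by
  rintro ⟨hpos, T, hT, hlen, w, hwlen, hw, hsum⟩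
  obtain ⟨T₁, T₂, rfl, hT₁, hT₂⟩ := List.sublist_append_iff.mp hT
  obtain ⟨m, hm, rfl⟩ := List.sublist_replicate_iff.mp hT₂
  rw [List.ofFn_eq_map] at hT₁
  obtain ⟨l, hl, rfl⟩ := List.sublist_map_iff.mp hT₁
  have hsorted : l.Pairwise (· < ·) := (List.pairwise_lt_finRange k).sublist hl
  cases l with
  | nil =>
    simp at hlen
    omega
  | cons i l =>
  cases w with
  | nil => simp at hwlen
  | cons a w =>
  have hdvd : ((p i * ∏ j ∈ Finset.Iio i, p j : ℕ) : ℤ) ∣ n := by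
    rw [Int.natCast_dvd_natCast, hn, ← Finset.prod_insert (by simp)]
    exact Finset.prod_dvd_prod_of_subset _ _ _ (Finset.subset_univ _)
  have hrest : (((p i * ∏ j ∈ Finset.Iio i, p j : ℕ) : ℤ) : ZMod n) ∣
      (List.zipWith (· * ·) w (l.map (fun i : Fin k =>
        (((∏ j ∈ Finset.Iio i, (p j : ℤ)) * b i : ℤ) : ZMod n)) ++ List.replicate m 0)).sum := by
    refine dvd_sum_zipWith_mul _ _ fun y hy => ?_
    rcases List.mem_append.mp hy with hy | hy
    · obtain ⟨j, hj, rfl⟩ := List.mem_map.mp hy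
      have hij : i < j := (List.pairwise_cons.mp hsorted).1 j hj
      refine map_dvd (Int.castRingHom (ZMod n)) (Dvd.dvd.mul_right ?_ _)
      rw [← Finset.prod_insert (by simp)]
      push_cast
      refine Finset.prod_dvd_prod_of_subset _ _ _ fun c hc => ?_
      rcases Finset.mem_insert.mp hc with rfl | hc
      · exact Finset.mem_Iio.mpr hij
      · exact Finset.mem_Iio.mpr ((Finset.mem_Iio.mp hc).trans hij)
    · rw [(List.mem_replicate.mp hy).2]
      exact dvd_zero _
  obtain ⟨c, hc⟩ := hrest
  obtain ⟨c, rfl⟩ := ZMod.intCast_surjective c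
  obtain ⟨a, rfl⟩ := ZMod.intCast_surjective a
  have ha : IsCoprime (n : ℤ) a :=
    (ZMod.coe_int_isUnit_iff_isCoprime a n).mp (hw _ List.mem_cons_self)
  simp only [List.map_cons, List.cons_append, List.zipWith_cons_cons, List.sum_cons, hc] at hsum
  rw [← Int.cast_mul, ← Int.cast_mul, ← Int.cast_add, ZMod.intCast_zmod_eq_zero_iff_dvd] at hsum
  have h1 := (dvd_add_left (dvd_mul_right _ c)).mp (hdvd.trans hsum)
  have h2 : (p i : ℤ) ∣ a * b i := by
    have hne : (∏ j ∈ Finset.Iio i, (p j : ℤ)) ≠ 0 :=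
      Finset.prod_ne_zero_iff.mpr fun j _ => by exact_mod_cast (hp j).ne_zero
    rw [Nat.cast_mul, Nat.cast_prod, mul_comm (p i : ℤ), mul_left_comm a] at h1
    exact (mul_dvd_mul_iff_left hne).mp h1
  have hpi := Nat.prime_iff_prime_int.mp (hp i)
  rcases hpi.dvd_or_dvd h2 with h | h
  · have hpn : (p i : ℤ) ∣ n := dvd_trans (by push_cast; exact dvd_mul_right _ _) hdvd
    exact hpi.not_isUnit (ha.isUnit_of_dvd' hpn h)
  · exact hpi.not_isUnit ((hb i).isUnit_of_dvd' h dvd_rfl)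

end Gao

/-- If `n = p 1 * ... * p k` is a factorization into primes and each `b i` is coprime to
`p i`, then the sequence `(b 1, p 1 * b 2, ..., p 1 * ... * p (k-1) * b k, 0, ..., 0)`
(with `n - 1` zeroes) is a `U(n)`-extremal sequence for the Gao constant. -/
theorem star_is_gao_extremal (k n : ℕ) (p : Fin k → ℕ) (hp : ∀ i, (p i).Prime)
    (hn : n = ∏ i, p i) (b : Fin k → ℤ) (hb : ∀ i, IsCoprime (b i) ((p i : ℤ))) :
    ((List.ofFn fun i : Fin k =>
        (((∏ j ∈ Finset.Iio i, (p j : ℤ)) * b i : ℤ) : ZMod n)) ++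
      List.replicate (n - 1) (0 : ZMod n)).length
        = n - 1 + (Nat.primeFactorsList n).length ∧
    IsGaoExtremal n (U n)
      ((List.ofFn fun i : Fin k =>
          (((∏ j ∈ Finset.Iio i, (p j : ℤ)) * b i : ℤ) : ZMod n)) ++
        List.replicate (n - 1) (0 : ZMod n)) := by
  have hn0 : n ≠ 0 := hn ▸ Finset.prod_ne_zero_iff.mpr fun i _ => (hp i).ne_zero
  have hΩ : (Nat.primeFactorsList n).length = k := by
    rw [← (Nat.primeFactorsList_unique (l := List.ofFn p) (by rw [List.prod_ofFn, hn])
      (by simpa [List.mem_ofFn] using hp)).length_eq, List.length_ofFn]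
  have hzero := not_hasWZSS_star hp hn hb
  have hlen : ((List.ofFn fun i : Fin k =>
        (((∏ j ∈ Finset.Iio i, (p j : ℤ)) * b i : ℤ) : ZMod n)) ++
      List.replicate (n - 1) (0 : ZMod n)).length
        = n - 1 + (Nat.primeFactorsList n).length := by
    rw [List.length_append, List.length_ofFn, List.length_replicate, hΩ, add_comm]
  refine ⟨hlen, ?_, hzero⟩
  rw [← ArithmeticFunction.cardFactors_apply] at hlen
  rw [gaoC_units_eq hn0 hlen hzero, hlen]
  omega
end

section
/- Suppose n = 2^{r+1} p_1 ⋯ p_k where r ≥ 1 and the p_i are odd primes. For 0 ≤ i ≤ r − 1 let a_i be an odd integer, let c be an integer divisible by 2^{r+1}, and for 1 ≤ i ≤ k let b_i be an odd integer coprime to p_i. If k ≥ 2, let S = (a_0, 2a_1, …, 2^{r−1} a_{r−1}, c, 2^r b_1, 2^r p_1 b_2, …, 2^r p_1 ⋯ p_{k−1} b_k, n/2, …, n/2), where n/2 occurs n − 1 times; if k = 1, let S = (a_0, 2a_1, …, 2^{r−1} a_{r−1}, c, 2^r, n/2, …, n/2), where n/2 occurs n − 1 times. Then S is a U(n)-extremal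 sequence for the Gao constant; in particular S has length n − 1 + Ω(n) and has no U(n)-weighted zero-sum subsequence of length n. -/
namespace UnitWeights

section Balanced

variable {ι κ : Type*}

/-- For every `p ∈ P`, no term of `T` is the unique minimiser of the height function `f p`,
unless its height reaches the cap `α p`. -/
def Balanced (P : Finset κ) (α : κ → ℕ) (f : κ → ι → ℕ) (T : Finset ι) : Prop :=
  ∀ p ∈ P, ∀ i ∈ T, f p i < α p → ∃ j ∈ T, j ≠ i ∧ f p j ≤ f p i

/-- The minimum of `α p` and of the heights `f p i` for `i ∈ R`. -/
def level (α : κ → ℕ) (f : κ → ι → ℕ) (p : κ) (R : Finset ι) : ℕ :=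
  ((Finset.range (α p)).filter fun v => ∀ i ∈ R, v < f p i).card

/-- The number of terms of `R` plus the sum of its levels. -/
def potential (P : Finset κ) (α : κ → ℕ) (f : κ → ι → ℕ) (R : Finset ι) : ℕ :=
  R.card + ∑ p ∈ P, level α f p R

variable {P : Finset κ} {α : κ → ℕ} {f : κ → ι → ℕ}

theorem level_anti {R R' : Finset ι} (h : R' ⊆ R) (p : κ) :
    level α f p R ≤ level α f p R' :=
  Finset.card_le_card fun v hv => by
    simp only [Finset.mem_filter] at hv ⊢
    exact ⟨hv.1, fun i hi => hv.2 i (h hi)⟩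

theorem level_le (p : κ) (R : Finset ι) : level α f p R ≤ α p :=
  (Finset.card_filter_le _ _).trans (Finset.card_range _).le

theorem level_lt_level_erase [DecidableEq ι] {R : Finset ι} {p : κ} {i : ι} (hi : i ∈ R)
    (hα : f p i < α p) (hmin : ∀ j ∈ R, j ≠ i → f p i < f p j) :
    level α f p R < level α f p (R.erase i) := by
  refine Finset.card_lt_card ⟨fun v hv => ?_, fun h => ?_⟩
  · simp only [Finset.mem_filter] at hv ⊢
    exact ⟨hv.1, fun j hj => hv.2 j (Finset.mem_of_mem_erase hj)⟩
  · have hmem : f p i ∈ (Finset.range (α p)).filter fun v => ∀ j ∈ R.erase i, v < f p j := by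
      simp only [Finset.mem_filter, Finset.mem_range]
      exact ⟨hα, fun j hj => hmin j (Finset.mem_of_mem_erase hj) (Finset.ne_of_mem_erase hj)⟩
    have := h hmem
    simp only [Finset.mem_filter] at this
    exact lt_irrefl _ (this.2 i hi)

theorem potential_le_potential_erase_add_one [DecidableEq ι] (R : Finset ι) (w : ι) :
    potential P α f R ≤ potential P α f (R.erase w) + 1 := by
  have h1 : ∑ p ∈ P, level α f p R ≤ ∑ p ∈ P, level α f p (R.erase w) :=
    Finset.sum_le_sum fun p _ => level_anti (Finset.erase_subset _ _) p
  have h2 : R.card - 1 ≤ (R.erase w).card := Finset.pred_card_le_card_erase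
  unfold potential
  omega

/-- Every finite set has a greatest balanced subset, and passing to it does not decrease the
potential. -/
theorem exists_greatest_balanced [DecidableEq ι] (R : Finset ι) :
    ∃ M ⊆ R, Balanced P α f M ∧ (∀ T ⊆ R, Balanced P α f T → T ⊆ M) ∧
      potential P α f R ≤ potential P α f M := by
  induction R using Finset.strongInduction with
  | H R ih =>
    by_cases hR : Balanced P α f R
    · exact ⟨R, subset_rfl, hR, fun T hT _ => hT, le_rfl⟩
    · unfold Balanced at hR
      push Not at hR
      obtain ⟨p, hp, i, hi, hα, hmin⟩ := hR
      obtain ⟨M, hMR, hM, hmax, hpot⟩ := ih (R.erase i) (Finset.erase_ssubset hi)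
      refine ⟨M, hMR.trans (Finset.erase_subset _ _), hM, fun T hT hbal => ?_, ?_⟩
      · refine hmax T (fun j hj => Finset.mem_erase.2 ⟨?_, hT hj⟩) hbal
        rintro rfl
        obtain ⟨k, hk, hkj, hle⟩ := hbal p hp j hj hα
        exact absurd hle (not_le.2 (hmin k (hT hk) hkj))
      · refine le_trans ?_ hpot
        have h1 : ∑ p ∈ P, level α f p R < ∑ p ∈ P, level α f p (R.erase i) :=
          Finset.sum_lt_sum (fun p _ => level_anti (Finset.erase_subset _ _) p)
            ⟨p, hp, level_lt_level_erase hi hα hmin⟩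
        have h2 := Finset.card_erase_add_one hi
        unfold potential
        omega

/-- If all principal lower sets of a finite preorder have sum zero, so has every lower set.
The preorder is given by the principal lower sets `cl w`. -/
theorem sum_eq_zero_of_sum_principal_eq_zero [DecidableEq ι] {G : Type*} [AddCommGroup G]
    (h : ι → G) (cl : ι → Finset ι) (hrefl : ∀ w, w ∈ cl w)
    (F : Finset ι) (htrans : ∀ w ∈ F, ∀ y ∈ cl w, cl y ⊆ cl w)
    (hzero : ∀ w ∈ F, ∑ i ∈ cl w, h i = 0) (hF : ∀ w ∈ F, cl w ⊆ F) :
    ∑ i ∈ F, h i = 0 := by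
  induction F using Finset.strongInduction with
  | H F ih =>
    rcases F.eq_empty_or_nonempty with rfl | hne
    · simp
    obtain ⟨w, hw, hmax⟩ := Finset.exists_max_image F (fun w => (cl w).card) hne
    have key : ∀ D ⊆ F, w ∈ D → (∀ y ∈ D, cl y ⊆ D) →
        ∑ i ∈ D with w ∉ cl i, h i = 0 := by
      intro D hDF hwD hD
      have hsub : D.filter (fun i => w ∉ cl i) ⊆ F := (Finset.filter_subset _ _).trans hDF
      refine ih _ ⟨hsub, fun hcon => ?_⟩ (fun y hy => htrans y (hsub hy))
        (fun y hy => hzero y (hsub hy)) ?_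
      · exact (Finset.mem_filter.1 (hcon hw)).2 (hrefl w)
      · intro y hy z hz
        obtain ⟨hyD, hwy⟩ := Finset.mem_filter.1 hy
        exact Finset.mem_filter.2 ⟨hD y hyD hz, fun hwz => hwy (htrans y (hDF hyD) z hz hwz)⟩
    have hclass : F.filter (fun i => w ∈ cl i) = (cl w).filter (fun i => w ∈ cl i) := by
      ext y
      simp only [Finset.mem_filter, and_congr_left_iff]
      intro hwy
      refine ⟨fun hy => ?_, fun hy => hF w hw hy⟩
      rw [Finset.eq_of_subset_of_card_le (htrans y hy w hwy) (hmax y hy)]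
      exact hrefl y
    have h1 := Finset.sum_filter_add_sum_filter_not (cl w) (fun i => w ∈ cl i) h
    rw [hzero w hw, key (cl w) (hF w hw) (hrefl w) (htrans w hw), add_zero] at h1
    rw [← Finset.sum_filter_add_sum_filter_not F (fun i => w ∈ cl i) h,
      key F subset_rfl hw hF, add_zero, hclass, h1]

/-- A balanced set has a balanced subset containing an even number of terms with property `H`,
at the cost of at most one unit of potential. -/
theorem exists_balanced_even_filter [DecidableEq ι] (H : ι → Prop) [DecidablePred H] {R : Finset ι}
    (hR : Balanced P α f R) :
    ∃ R₁ ⊆ R, Balanced P α f R₁ ∧ Even (R₁.filter H).card ∧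
      potential P α f R ≤ potential P α f R₁ + 1 := by
  by_contra! hcon
  choose M hMsub hM hmax hpot using
    fun w => exists_greatest_balanced (P := P) (α := α) (f := f) (R.erase w)
  have hMR : ∀ w, M w ⊆ R := fun w => (hMsub w).trans (Finset.erase_subset _ _)
  let h : ι → ZMod 2 := fun i => if H i then 1 else 0
  have hsum : ∀ X : Finset ι, ∑ i ∈ X, h i = 0 ↔ Even (X.filter H).card := by
    intro X
    simp only [h, Finset.sum_boole]
    exact ZMod.natCast_eq_zero_iff_even
  have hRodd : ∑ i ∈ R, h i ≠ 0 := fun hz =>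
    absurd (hcon R subset_rfl hR ((hsum R).1 hz)) (by omega)
  have hModd : ∀ w, ∑ i ∈ M w, h i ≠ 0 := fun w hz => by
    have h1 := hcon (M w) (hMR w) (hM w) ((hsum _).1 hz)
    have h2 := potential_le_potential_erase_add_one (P := P) (α := α) (f := f) R w
    have h3 := hpot w
    omega
  have hne : ∀ z : ZMod 2, z ≠ 0 → z = 1 := by decide
  let cl : ι → Finset ι := fun w => insert w (R \ M w)
  have hnot : ∀ w, w ∉ M w := fun w hw => Finset.notMem_erase w R (hMsub w hw)
  have hcl : ∀ w ∈ R, cl w = R \ M w := fun w hw =>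
    Finset.insert_eq_of_mem (Finset.mem_sdiff.2 ⟨hw, hnot w⟩)
  refine hRodd (sum_eq_zero_of_sum_principal_eq_zero h cl (fun w => Finset.mem_insert_self _ _)
    R ?_ ?_ ?_)
  · intro w hw y hy
    rw [hcl w hw] at hy ⊢
    obtain ⟨hyR, hyM⟩ := Finset.mem_sdiff.1 hy
    rw [hcl y hyR]
    refine Finset.sdiff_subset_sdiff subset_rfl (hmax y _ (fun z hz => ?_) (hM w))
    refine Finset.mem_erase.2 ⟨?_, hMR w hz⟩
    rintro rfl
    exact hyM hz
  · intro w hw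
    rw [hcl w hw]
    have := Finset.sum_sdiff (f := h) (hMR w)
    rw [hne _ hRodd, hne _ (hModd w)] at this
    simpa using this
  · intro w hw
    rw [hcl w hw]
    exact Finset.sdiff_subset

/-- A balanced set has a small subset all of whose supersets inside it are balanced. -/
theorem exists_core [DecidableEq ι] {R : Finset ι} (hR : Balanced P α f R) :
    ∃ C ⊆ R, C.card ≤ 2 * P.card ∧ ∀ T, C ⊆ T → T ⊆ R → Balanced P α f T := by
  have hpair : ∀ p ∈ P, ∃ C ⊆ R, C.card ≤ 2 ∧ ∀ T, C ⊆ T → T ⊆ R →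
      ∀ i ∈ T, f p i < α p → ∃ j ∈ T, j ≠ i ∧ f p j ≤ f p i := by
    intro p hp
    by_cases hlow : ∃ i ∈ R, f p i < α p
    · obtain ⟨k, hk, hkα⟩ := hlow
      obtain ⟨i, hi, hmin⟩ := Finset.exists_min_image R (f p) ⟨k, hk⟩
      obtain ⟨j, hj, hji, hle⟩ := hR p hp i hi ((hmin k hk).trans_lt hkα)
      refine ⟨{i, j}, ?_, Finset.card_le_two, fun T hC hT l hl _ => ?_⟩
      · simp [Finset.insert_subset_iff, hi, hj]
      · by_cases hli : l = i
        · exact ⟨j, hC (by simp), by rwa [hli], by rwa [hli]⟩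
        · exact ⟨i, hC (by simp), Ne.symm hli, hmin l (hT hl)⟩
    · push Not at hlow
      exact ⟨∅, by simp, by simp, fun T _ hT i hi hlt => absurd hlt (not_lt.2 (hlow i (hT hi)))⟩
  choose! C hCR hcard hC using hpair
  refine ⟨P.biUnion C, Finset.biUnion_subset.2 hCR, ?_, fun T hCT hT p hp =>
    hC p hp T ((Finset.subset_biUnion_of_mem C hp).trans hCT) hT⟩
  calc (P.biUnion C).card ≤ P.card * 2 := Finset.card_biUnion_le_card_mul _ _ _ hcard
    _ = 2 * P.card := mul_comm _ _

/-- The number of terms of `T` of minimal height `v` is even whenever `v < a`. -/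
def EvenMin (a : ℕ) (g : ι → ℕ) (T : Finset ι) : Prop :=
  ∀ v < a, (∀ i ∈ T, v ≤ g i) → Even (T.filter fun i => g i = v).card

theorem evenMin_of_even {a v : ℕ} {g : ι → ℕ} {T : Finset ι} (hv : ∀ i ∈ T, v ≤ g i)
    (heven : Even (T.filter fun i => g i = v).card) (hne : ∃ i ∈ T, g i = v) :
    EvenMin a g T := by
  intro u _ hu
  obtain ⟨i, hi, rfl⟩ := hne
  rcases (hu i hi).eq_or_lt with rfl | hlt
  · exact heven
  · rw [Finset.filter_eq_empty_iff.2 fun j hj => (hlt.trans_le (hv j hj)).ne']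
    simp

theorem le_card_of_le_potential {R : Finset ι} {N : ℕ}
    (h : N + ∑ p ∈ P, α p ≤ potential P α f R) : N ≤ R.card := by
  have : ∑ p ∈ P, level α f p R ≤ ∑ p ∈ P, α p := Finset.sum_le_sum fun p _ => level_le p R
  unfold potential at h
  omega

/-- If `R` has more than `N` terms, many of them of minimal height `v` and many of larger
height, a balanced set of `N` terms can be chosen freely with the right parity. -/
theorem exists_balanced_evenMin_of_many [DecidableEq ι] {R : Finset ι} {a v N : ℕ} {g : ι → ℕ}
    (hR : Balanced P α f R) (hv : ∀ i ∈ R, v ≤ g i) (hN : 2 * P.card + 2 ≤ N)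
    (hcard : N + 1 ≤ R.card)
    (hO : 2 * P.card + 1 < (R.filter fun i => g i = v).card)
    (hE : 2 * P.card + 1 < (R.filter fun i => g i ≠ v).card) :
    ∃ T ⊆ R, T.card = N ∧ Balanced P α f T ∧ EvenMin a g T := by
  obtain ⟨C, hCR, hCcard, hC⟩ := exists_core hR
  obtain ⟨o₁, ho₁, ho₁C⟩ := Finset.exists_mem_notMem_of_card_lt_card
    (s := C) (t := R.filter fun i => g i = v) (by omega)
  have hins : (insert o₁ C).card ≤ C.card + 1 := Finset.card_insert_le _ _
  obtain ⟨o₂, ho₂, ho₂C⟩ := Finset.exists_mem_notMem_of_card_lt_card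
    (s := insert o₁ C) (t := R.filter fun i => g i = v) (by omega)
  obtain ⟨e₁, he₁, he₁C⟩ := Finset.exists_mem_notMem_of_card_lt_card
    (s := C) (t := R.filter fun i => g i ≠ v) (by omega)
  obtain ⟨ho₁R, ho₁v⟩ := Finset.mem_filter.1 ho₁
  obtain ⟨ho₂R, ho₂v⟩ := Finset.mem_filter.1 ho₂
  obtain ⟨he₁R, he₁v⟩ := Finset.mem_filter.1 he₁
  have hsub : insert o₁ C ⊆ (R.erase o₂).erase e₁ := by
    intro i hi
    have hi1 : i ≠ o₂ := by rintro rfl; exact ho₂C hi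
    have hi2 : i ≠ e₁ := by
      rintro rfl
      rcases Finset.mem_insert.1 hi with rfl | hi
      · exact he₁v ho₁v
      · exact he₁C hi
    refine Finset.mem_erase.2 ⟨hi2, Finset.mem_erase.2 ⟨hi1, ?_⟩⟩
    rcases Finset.mem_insert.1 hi with rfl | hi
    · exact ho₁R
    · exact hCR hi
  have hc1 : R.card - 1 ≤ (R.erase o₂).card := Finset.pred_card_le_card_erase
  have hc2 : (R.erase o₂).card - 1 ≤ ((R.erase o₂).erase e₁).card :=
    Finset.pred_card_le_card_erase
  obtain ⟨T, hCT, hTR, hTcard⟩ := Finset.exists_subsuperset_card_eq hsub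
    (n := N - 1) (by omega) (by omega)
  have hTR' : T ⊆ R := hTR.trans ((Finset.erase_subset _ _).trans (Finset.erase_subset _ _))
  have ho₂T : o₂ ∉ T := fun h => by simpa using hTR h
  have he₁T : e₁ ∉ T := fun h => by simpa using hTR h
  have hbal : ∀ x ∈ R, Balanced P α f (insert x T) := fun x hx =>
    hC _ ((Finset.subset_insert _ _).trans (hCT.trans (Finset.subset_insert _ _)))
      (Finset.insert_subset hx hTR')
  have ho₁T : o₁ ∈ T := hCT (Finset.mem_insert_self _ _)
  by_cases hpar : Even (T.filter fun i => g i = v).card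
  · refine ⟨insert e₁ T, Finset.insert_subset he₁R hTR', ?_, hbal e₁ he₁R, ?_⟩
    · rw [Finset.card_insert_of_notMem he₁T]; omega
    · refine evenMin_of_even (fun i hi => hv i (Finset.insert_subset he₁R hTR' hi)) ?_
        ⟨o₁, Finset.mem_insert_of_mem ho₁T, ho₁v⟩
      rwa [Finset.filter_insert, if_neg he₁v]
  · refine ⟨insert o₂ T, Finset.insert_subset ho₂R hTR', ?_, hbal o₂ ho₂R, ?_⟩
    · rw [Finset.card_insert_of_notMem ho₂T]; omega
    · refine evenMin_of_even (fun i hi => hv i (Finset.insert_subset ho₂R hTR' hi)) ?_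
        ⟨o₁, Finset.mem_insert_of_mem ho₁T, ho₁v⟩
      rw [Finset.filter_insert, if_pos ho₂v,
        Finset.card_insert_of_notMem fun h => ho₂T (Finset.mem_of_mem_filter _ h)]
      exact (Nat.not_even_iff_odd.1 hpar).add_one

theorem exists_balanced_card_eq_superset [DecidableEq ι] {R X : Finset ι} {N B : ℕ}
    (hR : Balanced P α f R) (hX : X ⊆ R) (hXB : X.card ≤ B) (hN : 2 * P.card + B ≤ N)
    (hcard : N ≤ R.card) :
    ∃ T, X ⊆ T ∧ T ⊆ R ∧ T.card = N ∧ Balanced P α f T := by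
  obtain ⟨C, hCR, hCcard, hC⟩ := exists_core hR
  have hcu := Finset.card_union_le C X
  obtain ⟨T, hCT, hTR, hTcard⟩ := Finset.exists_subsuperset_card_eq
    (Finset.union_subset hCR hX) (n := N) (by omega) hcard
  exact ⟨T, Finset.subset_union_right.trans hCT, hTR, hTcard,
    hC T (Finset.subset_union_left.trans hCT) hTR⟩

theorem exists_balanced_evenMin_of_height_ge [DecidableEq ι] {a N : ℕ} {g : ι → ℕ} (hNeven : Even N)
    (hN : 4 * P.card + 2 ≤ N) (d v : ℕ) (hd : v + d = a) (R : Finset ι)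
    (hR : Balanced P α f R) (hv : ∀ i ∈ R, v ≤ g i)
    (hpot : N + d + ∑ p ∈ P, α p ≤ potential P α f R) :
    ∃ T ⊆ R, T.card = N ∧ Balanced P α f T ∧ EvenMin a g T := by
  induction d generalizing v R with
  | zero =>
    obtain ⟨T, -, hTR, hTcard, hT⟩ := exists_balanced_card_eq_superset (N := N) (B := 0) hR
      (Finset.empty_subset R) le_rfl (by omega) (le_card_of_le_potential hpot)
    refine ⟨T, hTR, hTcard, hT, fun u hu _ => ?_⟩
    rw [Finset.filter_eq_empty_iff.2 fun j hj => ?_]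
    · simp
    · have := hv j (hTR hj)
      omega
  | succ d ih =>
    by_cases hO : (R.filter fun i => g i = v).card ≤ 2 * P.card + 1
    · obtain ⟨R₁, hR₁R, hR₁, heven, hpot₁⟩ := exists_balanced_even_filter (fun i => g i = v) hR
      by_cases hne : ∃ i ∈ R₁, g i = v
      · obtain ⟨T, hXT, hTR, hTcard, hT⟩ := exists_balanced_card_eq_superset (N := N) hR₁
          (Finset.filter_subset (fun i => g i = v) R₁)
          ((Finset.card_le_card (Finset.filter_subset_filter _ hR₁R)).trans hO) (by omega)
          (le_card_of_le_potential (P := P) (α := α) (f := f) (by omega))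
        refine ⟨T, hTR.trans hR₁R, hTcard, hT,
          evenMin_of_even (fun i hi => hv i (hR₁R (hTR hi))) ?_ ?_⟩
        · rwa [Finset.Subset.antisymm (Finset.filter_subset_filter _ hTR)
            (fun i hi => Finset.mem_filter.2 ⟨hXT hi, (Finset.mem_filter.1 hi).2⟩)]
        · obtain ⟨i, hi, hiv⟩ := hne
          exact ⟨i, hXT (Finset.mem_filter.2 ⟨hi, hiv⟩), hiv⟩
      · push Not at hne
        obtain ⟨T, hTR, hT⟩ := ih (v + 1) (by omega) R₁ hR₁
          (fun i hi => lt_of_le_of_ne (hv i (hR₁R hi)) (hne i hi).symm) (by omega)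
        exact ⟨T, hTR.trans hR₁R, hT⟩
    by_cases hE : (R.filter fun i => g i ≠ v).card ≤ 2 * P.card + 1
    · obtain ⟨R₁, hR₁R, hR₁, heven, hpot₁⟩ := exists_balanced_even_filter (fun i => g i ≠ v) hR
      have hE₁ := (Finset.card_le_card
        (Finset.filter_subset_filter (fun i => g i ≠ v) hR₁R)).trans hE
      obtain ⟨T, hXT, hTR, hTcard, hT⟩ := exists_balanced_card_eq_superset (N := N) hR₁
          (Finset.filter_subset (fun i => g i ≠ v) R₁) hE₁ (by omega)
          (le_card_of_le_potential (P := P) (α := α) (f := f) (by omega))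
      have hfil : T.filter (fun i => g i ≠ v) = R₁.filter (fun i => g i ≠ v) :=
        Finset.Subset.antisymm (Finset.filter_subset_filter _ hTR)
          (fun i hi => Finset.mem_filter.2 ⟨hXT hi, (Finset.mem_filter.1 hi).2⟩)
      have hsplit := Finset.card_filter_add_card_filter_not (s := T) (fun i => g i = v)
      rw [show (T.filter fun i => ¬ g i = v) = R₁.filter (fun i => g i ≠ v) from hfil] at hsplit
      have hcard_even : Even (T.filter fun i => g i = v).card := by
        have : Even ((T.filter fun i => g i = v).card +
            (R₁.filter fun i => g i ≠ v).card) := by rwa [hsplit, hTcard]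
        exact (Nat.even_add.1 this).2 heven
      refine ⟨T, hTR.trans hR₁R, hTcard, hT,
        evenMin_of_even (fun i hi => hv i (hR₁R (hTR hi))) hcard_even ?_⟩
      obtain ⟨i, hi⟩ : (T.filter fun i => g i = v).Nonempty := Finset.card_pos.1 (by omega)
      exact ⟨i, Finset.mem_filter.1 hi⟩
    · exact exists_balanced_evenMin_of_many hR hv (by omega)
        (le_card_of_le_potential (P := P) (α := α) (f := f) (by omega)) (by omega) (by omega)

/-- The combinatorial core of the upper bound: from `N + a + ∑ α p` terms one can choose `N`
that are balanced and have an even number of terms of minimal height. -/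
theorem exists_balanced_evenMin [DecidableEq ι] {a N : ℕ} {g : ι → ℕ} (hNeven : Even N)
    (hN : 4 * P.card + 2 ≤ N) (R : Finset ι) (hcard : N + a + ∑ p ∈ P, α p ≤ R.card) :
    ∃ T ⊆ R, T.card = N ∧ Balanced P α f T ∧ EvenMin a g T := by
  obtain ⟨M, hMR, hM, -, hpot⟩ := exists_greatest_balanced (P := P) (α := α) (f := f) R
  obtain ⟨T, hTM, hT⟩ := exists_balanced_evenMin_of_height_ge (g := g) hNeven hN a 0
    (zero_add a) M hM (fun i _ => Nat.zero_le _)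
    (hcard.trans ((Nat.le_add_right _ _).trans hpot))
  exact ⟨T, hTM.trans hMR, hT⟩

end Balanced

section PrimePower

variable {ι : Type*}

/-- Adjusting the weight of a single term coprime to `p` makes a weighted sum vanish modulo
`p ^ e`, provided the contribution of the other terms is coprime to `p`. -/
theorem exists_weights_of_coprime_rest [DecidableEq ι] {p : ℕ} (hp : p.Prime) (e : ℕ)
    {T : Finset ι} {j : ι} (hj : j ∈ T) (w z : ι → ℕ) (hw : ∀ i, (w i).Coprime p)
    (hz : (z j).Coprime p) (hrest : (∑ i ∈ T.erase j, w i * z i).Coprime p) :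
    ∃ w' : ι → ℕ, (∀ i, (w' i).Coprime p) ∧ p ^ e ∣ ∑ i ∈ T, w' i * z i := by
  rcases Nat.eq_zero_or_pos e with rfl | he
  · exact ⟨w, hw, by simp⟩
  have : NeZero (p ^ e) := ⟨(pow_pos hp.pos e).ne'⟩
  obtain ⟨u, hu⟩ := (ZMod.isUnit_iff_coprime _ _).2 (hz.pow_right e)
  obtain ⟨s, hs⟩ := (ZMod.isUnit_iff_coprime _ _).2 (hrest.pow_right e)
  let t : (ZMod (p ^ e))ˣ := -s * u⁻¹
  have ht : (t : ZMod (p ^ e)).val.Coprime p :=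
    (Nat.coprime_pow_right_iff he _ _).1 (ZMod.val_coe_unit_coprime t)
  refine ⟨Function.update w j (t : ZMod (p ^ e)).val, fun i => ?_, ?_⟩
  · by_cases hij : i = j
    · subst hij
      simpa using ht
    · simpa [hij] using hw i
  · rw [← Finset.add_sum_erase _ _ hj]
    have hcongr : ∑ i ∈ T.erase j, Function.update w j (t : ZMod (p ^ e)).val i * z i =
        ∑ i ∈ T.erase j, w i * z i :=
      Finset.sum_congr rfl fun i hi => by
        rw [Function.update_of_ne (Finset.ne_of_mem_erase hi)]
    rw [hcongr, Function.update_self, ← ZMod.natCast_eq_zero_iff, Nat.cast_add, Nat.cast_mul,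
      ZMod.natCast_zmod_val, ← hu, ← hs]
    simp [t]

/-- Two terms coprime to an odd prime `p` suffice for a zero sum modulo `p ^ e` with weights
coprime to `p`. -/
theorem exists_weights_of_odd_prime [DecidableEq ι] {p : ℕ} (hp : p.Prime) (hp2 : p ≠ 2) (e : ℕ)
    {T : Finset ι} {i j : ι} (hi : i ∈ T) (hj : j ∈ T) (hij : j ≠ i) (z : ι → ℕ)
    (hzi : (z i).Coprime p) (hzj : (z j).Coprime p) :
    ∃ w : ι → ℕ, (∀ i, (w i).Coprime p) ∧ p ^ e ∣ ∑ i ∈ T, w i * z i := by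
  have hiT : i ∈ T.erase j := Finset.mem_erase.2 ⟨hij.symm, hi⟩
  have hsum : ∀ s : ℕ, ∑ k ∈ T.erase j, Function.update (fun _ => 1) i s k * z k =
      s * z i + ∑ k ∈ (T.erase j).erase i, z k := by
    intro s
    rw [← Finset.add_sum_erase _ _ hiT, Function.update_self]
    congr 1
    exact Finset.sum_congr rfl fun k hk => by
      rw [Function.update_of_ne (Finset.ne_of_mem_erase hk), one_mul]
  have hw : ∀ s : ℕ, s.Coprime p →
      ∀ k, (Function.update (fun _ => 1) i s k : ℕ).Coprime p := by
    intro s hs k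
    by_cases hki : k = i
    · subst hki
      simpa using hs
    · simp [hki]
  by_cases h1 : (1 * z i + ∑ k ∈ (T.erase j).erase i, z k).Coprime p
  · exact exists_weights_of_coprime_rest hp e hj _ z (hw 1 (Nat.coprime_one_left p)) hzj
      (by rwa [hsum])
  · have h2 : (2 : ℕ).Coprime p := (Nat.coprime_primes Nat.prime_two hp).2 (Ne.symm hp2)
    refine exists_weights_of_coprime_rest hp e hj _ z (hw 2 h2) hzj ?_
    rw [hsum]
    rw [Nat.coprime_comm, hp.coprime_iff_not_dvd, not_not] at h1
    rw [Nat.coprime_comm, hp.coprime_iff_not_dvd] at hzi ⊢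
    intro h
    refine hzi ((Nat.dvd_add_right h1).1 ?_)
    convert h using 1
    ring

/-- A positive even number of odd terms suffices for a zero sum modulo `2 ^ e` with odd
weights. -/
theorem exists_weights_of_even_card_odd [DecidableEq ι] (e : ℕ) {T : Finset ι} {j : ι} (hj : j ∈ T)
    (z : ι → ℕ) (hzj : Odd (z j)) (heven : Even (T.filter fun i => Odd (z i)).card) :
    ∃ w : ι → ℕ, (∀ i, (w i).Coprime 2) ∧ 2 ^ e ∣ ∑ i ∈ T, w i * z i := by
  refine exists_weights_of_coprime_rest Nat.prime_two e hj (fun _ => 1) z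
    (fun _ => Nat.coprime_one_left 2) (Nat.coprime_two_right.2 hzj) (Nat.coprime_two_right.2 ?_)
  have h1 : Even (∑ i ∈ T, z i) := by
    rwa [← Nat.not_odd_iff_even, Finset.odd_sum_iff_odd_card_odd, Nat.not_odd_iff_even]
  rw [← Finset.add_sum_erase _ _ hj, Nat.even_add] at h1
  simp only [one_mul]
  rw [← Nat.not_even_iff_odd, ← h1, Nat.not_even_iff_odd]
  exact hzj

/-- The exponent of `p` in `y`, capped by its exponent in `n`. -/
def cappedVal (n p y : ℕ) : ℕ := (y.gcd n).factorization p

theorem pow_dvd_iff_le_cappedVal {n p k y : ℕ} (hn : n ≠ 0) (hp : p.Prime)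
    (hk : k ≤ n.factorization p) : p ^ k ∣ y ↔ k ≤ cappedVal n p y := by
  rw [cappedVal, ← hp.pow_dvd_iff_le_factorization (Nat.gcd_ne_zero_right hn), Nat.dvd_gcd_iff]
  exact (and_iff_left ((hp.pow_dvd_iff_le_factorization hn).2 hk)).symm

/-- A common factor `p ^ v` can be removed before looking for weights, and the cofactor of a
term of capped valuation exactly `v` is coprime to `p`. -/
theorem exists_cofactors {n p v : ℕ} (hn : n ≠ 0) (hp : p.Prime) (hv : v < n.factorization p)
    {T : Finset ι} (y : ι → ℕ) (hT : ∀ i ∈ T, v ≤ cappedVal n p (y i)) :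
    ∃ z : ι → ℕ, (∀ i ∈ T, y i = p ^ v * z i) ∧
      ∀ i ∈ T, ((z i).Coprime p ↔ cappedVal n p (y i) = v) := by
  have hdvd : ∀ i ∈ T, ∃ z, y i = p ^ v * z := fun i hi =>
    (pow_dvd_iff_le_cappedVal hn hp hv.le).2 (hT i hi)
  choose! z hz using hdvd
  refine ⟨z, hz, fun i hi => ?_⟩
  have hsucc := pow_dvd_iff_le_cappedVal (y := y i) hn hp (Nat.succ_le_of_lt hv)
  rw [hz i hi, pow_succ, Nat.mul_dvd_mul_iff_left (pow_pos hp.pos v), ← hz i hi] at hsucc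
  rw [Nat.coprime_comm, hp.coprime_iff_not_dvd, hsucc]
  have := hT i hi
  omega

theorem pow_dvd_sum_of_cofactors {p v e : ℕ} {T : Finset ι} {w y z : ι → ℕ}
    (hz : ∀ i ∈ T, y i = p ^ v * z i) (h : p ^ e ∣ ∑ i ∈ T, w i * z i) :
    p ^ e ∣ ∑ i ∈ T, w i * y i := by
  have : ∑ i ∈ T, w i * y i = p ^ v * ∑ i ∈ T, w i * z i := by
    rw [Finset.mul_sum]
    exact Finset.sum_congr rfl fun i hi => by rw [hz i hi]; ring
  rw [this]
  exact h.mul_left _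

/-- A sequence of terms that is balanced at every odd prime and even at the prime two is a
zero-sum sequence modulo every prime power dividing `n`, with weights coprime to that prime. -/
theorem exists_weights_of_balanced [DecidableEq ι] {n : ℕ} (hn : n ≠ 0) {T : Finset ι} (y : ι → ℕ)
    (hbal : Balanced (n.primeFactors.erase 2) n.factorization (fun p i => cappedVal n p (y i)) T)
    (heven : EvenMin (n.factorization 2) (fun i => cappedVal n 2 (y i)) T)
    {p : ℕ} (hp : p ∈ n.primeFactors) :
    ∃ w : ι → ℕ, (∀ i, (w i).Coprime p) ∧ p ^ n.factorization p ∣ ∑ i ∈ T, w i * y i := by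
  have hpp := Nat.prime_of_mem_primeFactors hp
  by_cases hlow : ∃ i ∈ T, cappedVal n p (y i) < n.factorization p
  · obtain ⟨k, hk, hkn⟩ := hlow
    obtain ⟨i, hi, hmin⟩ := Finset.exists_min_image T (fun i => cappedVal n p (y i)) ⟨k, hk⟩
    have hin := (hmin k hk).trans_lt hkn
    obtain ⟨z, hz, hzcop⟩ := exists_cofactors hn hpp hin y hmin
    suffices h : ∃ w : ι → ℕ, (∀ i, (w i).Coprime p) ∧
        p ^ n.factorization p ∣ ∑ i ∈ T, w i * z i by
      obtain ⟨w, hw, hsum⟩ := h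
      exact ⟨w, hw, pow_dvd_sum_of_cofactors hz hsum⟩
    have hzi := (hzcop i hi).2 rfl
    by_cases hp2 : p = 2
    · subst hp2
      refine exists_weights_of_even_card_odd _ hi z (Nat.coprime_two_right.1 hzi) ?_
      convert heven _ hin hmin using 2
      exact Finset.filter_congr fun l hl => Nat.coprime_two_right.symm.trans (hzcop l hl)
    · obtain ⟨j, hj, hji, hle⟩ := hbal p (Finset.mem_erase.2 ⟨hp2, hp⟩) i hi hin
      exact exists_weights_of_odd_prime hpp hp2 _ hi hj hji z hzi
        ((hzcop j hj).2 (le_antisymm hle (hmin j hj)))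
  · push Not at hlow
    exact ⟨fun _ => 1, fun _ => Nat.coprime_one_left p, Finset.dvd_sum fun i hi =>
      ((pow_dvd_iff_le_cappedVal hn hpp le_rfl).2 (hlow i hi)).mul_left _⟩

/-- Weights coprime to `p` that work modulo each prime power `p ^ n.factorization p` can be glued
to weights that are units modulo `n`. -/
theorem exists_unit_weights {n : ℕ} (hn : n ≠ 0) {T : Finset ι} (y : ι → ℕ)
    (h : ∀ p ∈ n.primeFactors, ∃ w : ι → ℕ, (∀ i, (w i).Coprime p) ∧
      p ^ n.factorization p ∣ ∑ i ∈ T, w i * y i) :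
    ∃ w : ι → ℕ, (∀ i, (w i).Coprime n) ∧ n ∣ ∑ i ∈ T, w i * y i := by
  choose! w hw hsum using h
  have hcop : Set.Pairwise (n.primeFactors : Set ℕ)
      (Function.onFun Nat.Coprime fun p => p ^ n.factorization p) := fun p hp q hq hpq =>
    Nat.coprime_pow_primes _ _ (Nat.prime_of_mem_primeFactors hp)
      (Nat.prime_of_mem_primeFactors hq) hpq
  have hcrt : ∀ i, ∃ x : ℕ, ∀ p ∈ n.primeFactors, x ≡ w p i [MOD p ^ n.factorization p] :=
    fun i => ⟨_, (Nat.chineseRemainderOfFinset (fun p => w p i) (fun p => p ^ n.factorization p)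
      n.primeFactors (fun p hp => (pow_pos (Nat.prime_of_mem_primeFactors hp).pos _).ne')
      hcop).2⟩
  choose x hx using hcrt
  refine ⟨x, fun i => Nat.coprime_of_dvd fun p hp hpx hpn => ?_, ?_⟩
  · have hmem : p ∈ n.primeFactors := Nat.mem_primeFactors.2 ⟨hp, hpn, hn⟩
    have hmod := (hx i p hmem).of_dvd
      (dvd_pow_self p ((hp.factorization_pos_of_dvd hn hpn).ne'))
    have hdvd : p ∣ w p i := (hmod.dvd_iff dvd_rfl).1 hpx
    have := hw p hmem i
    rw [Nat.coprime_comm, hp.coprime_iff_not_dvd] at this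
    exact this hdvd
  · rw [Nat.dvd_iff_prime_pow_dvd_dvd]
    intro p k hp hpk
    rcases Nat.eq_zero_or_pos k with rfl | hk
    · simp
    have hmem : p ∈ n.primeFactors :=
      Nat.mem_primeFactors.2 ⟨hp, (dvd_pow_self p hk.ne').trans hpk, hn⟩
    refine (pow_dvd_pow p ((hp.pow_dvd_iff_le_factorization hn).1 hpk)).trans ?_
    have hmod : ∑ i ∈ T, x i * y i ≡ ∑ i ∈ T, w p i * y i [MOD p ^ n.factorization p] := by
      rw [← ZMod.natCast_eq_natCast_iff]
      push_cast
      exact Finset.sum_congr rfl fun i _ => by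
        rw [(ZMod.natCast_eq_natCast_iff _ _ _).2 (hx i p hmem)]
    exact (hmod.dvd_iff dvd_rfl).2 (hsum p hmem)

end PrimePower

section UpperBound

theorem length_primeFactorsList_eq_sum_factorization (n : ℕ) :
    n.primeFactorsList.length = ∑ p ∈ n.primeFactors, n.factorization p := by
  rw [← ArithmeticFunction.cardFactors_apply, ArithmeticFunction.cardFactors_eq_sum_factorization]
  rfl

theorem four_mul_card_odd_primeFactors_add_two_le {n : ℕ} (hn : n ≠ 0) (heven : Even n) :
    4 * (n.primeFactors.erase 2).card + 2 ≤ n := by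
  have h2 : 2 ∈ n.primeFactors := Nat.mem_primeFactors.2 ⟨Nat.prime_two, heven.two_dvd, hn⟩
  have hprod : ∏ p ∈ n.primeFactors, p ≤ n :=
    Nat.le_of_dvd (Nat.pos_of_ne_zero hn) (Nat.prod_primeFactors_dvd n)
  rw [← Finset.mul_prod_erase _ _ h2] at hprod
  have hpow : 3 ^ (n.primeFactors.erase 2).card ≤ ∏ p ∈ n.primeFactors.erase 2, p :=
    Finset.pow_card_le_prod _ _ _ fun p hp => by
      obtain ⟨hp2, hp⟩ := Finset.mem_erase.1 hp
      have := (Nat.prime_of_mem_primeFactors hp).two_le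
      omega
  have hbern := one_add_mul_le_pow (a := (2 : ℤ)) (by norm_num) (n.primeFactors.erase 2).card
  have hbern' : 1 + (n.primeFactors.erase 2).card * 2 ≤ 3 ^ (n.primeFactors.erase 2).card := by
    exact_mod_cast hbern
  omega

/-- For even `n`, every sequence of length `n + Ω(n)` has a `U(n)`-weighted zero-sum subsequence
of length `n`. -/
theorem hasWZSS_of_length_eq {n : ℕ} (hn : n ≠ 0) (heven : Even n) (S : List (ZMod n))
    (hS : S.length = n + n.primeFactorsList.length) : HasWZSS (U n) S n := by
  have : NeZero n := ⟨hn⟩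
  let x : Fin S.length → ZMod n := S.get
  have h2 : 2 ∈ n.primeFactors := Nat.mem_primeFactors.2 ⟨Nat.prime_two, heven.two_dvd, hn⟩
  obtain ⟨T, -, hTcard, hbal, hmin⟩ := exists_balanced_evenMin
    (P := n.primeFactors.erase 2) (α := n.factorization)
    (f := fun p i => cappedVal n p (x i).val) (a := n.factorization 2)
    (g := fun i => cappedVal n 2 (x i).val) heven
    (four_mul_card_odd_primeFactors_add_two_le hn heven) Finset.univ (by
      rw [Finset.card_univ, Fintype.card_fin, hS, length_primeFactorsList_eq_sum_factorization,
        ← Finset.add_sum_erase _ _ h2, add_assoc])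
  obtain ⟨w, hw, hsum⟩ := exists_unit_weights hn (T := T) (fun i => (x i).val)
    fun p hp => exists_weights_of_balanced hn _ hbal hmin hp
  let I : List (Fin S.length) := (List.finRange S.length).filter (· ∈ T)
  have hnodup : I.Nodup := (List.nodup_finRange _).filter _
  have hI : I.toFinset = T := by ext; simp [I]
  refine ⟨Nat.pos_of_ne_zero hn, I.map x, ?_, ?_, I.map fun i => (w i : ZMod n), ?_, ?_, ?_⟩
  · have hsub : (I.map x).Sublist ((List.finRange S.length).map x) := List.filter_sublist.map x
    simpa [x] using hsub
  · rw [List.length_map, ← List.toFinset_card_of_nodup hnodup, hI, hTcard]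
  · simp
  · intro u hu
    obtain ⟨i, -, rfl⟩ := List.mem_map.1 hu
    exact (ZMod.isUnit_iff_coprime _ _).2 (hw i)
  · have hzip : List.zipWith (· * ·) (I.map fun i => (w i : ZMod n)) (I.map x) =
        I.map fun i => (w i : ZMod n) * x i := by simp
    rw [hzip, ← List.sum_toFinset _ hnodup, hI]
    have hcast := (ZMod.natCast_eq_zero_iff _ n).2 hsum
    push_cast at hcast
    simpa using hcast

end UpperBound

section LowerBound

variable {n : ℕ}

theorem intCast_dvd_intCast_iff {q y : ℤ} (hq : q ∣ n) :
    (q : ZMod n) ∣ (y : ZMod n) ↔ q ∣ y := by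
  refine ⟨?_, fun h => by simpa using map_dvd (Int.castRingHom (ZMod n)) h⟩
  rintro ⟨z, hz⟩
  obtain ⟨z, rfl⟩ := ZMod.intCast_surjective z
  rw [← Int.cast_mul, ZMod.intCast_eq_intCast_iff_dvd_sub] at hz
  have h := hq.trans hz
  exact (dvd_sub_right (dvd_mul_right q z)).1 h

theorem dvd_sum_zipWith_mul {R : Type*} [CommRing R] {q : R} {T : List R}
    (hT : ∀ y ∈ T, q ∣ y) (w : List R) : q ∣ (List.zipWith (· * ·) w T).sum := by
  induction T generalizing w with
  | nil => simp
  | cons y T ih =>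
    cases w with
    | nil => simp
    | cons u w =>
      rw [List.zipWith_cons_cons, List.sum_cons]
      exact dvd_add ((hT y (by simp)).mul_left u) (ih (fun z hz => hT z (by simp [hz])) w)

theorem isWZSum_cons_iff {A : Set (ZMod n)} {x : ZMod n} {T : List (ZMod n)} :
    IsWZSum A (x :: T) ↔ ∃ u ∈ A, ∃ w : List (ZMod n), w.length = T.length ∧
      (∀ a ∈ w, a ∈ A) ∧ u * x + (List.zipWith (· * ·) w T).sum = 0 := by
  constructor
  · rintro ⟨_ | ⟨u, w⟩, hlen, hw, hsum⟩
    · simp at hlen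
    · exact ⟨u, hw u (by simp), w, by simpa using hlen, fun a ha => hw a (by simp [ha]),
        by simpa using hsum⟩
  · rintro ⟨u, hu, w, hlen, hw, hsum⟩
    refine ⟨u :: w, by simpa using hlen, ?_, by simpa using hsum⟩
    simpa [hu] using hw

/-- In a unit-weighted zero-sum sequence, a divisor of all terms but the first also divides the
first. -/
theorem dvd_of_isWZSum_cons {q x : ZMod n} {T : List (ZMod n)} (hT : ∀ y ∈ T, q ∣ y)
    (h : IsWZSum (U n) (x :: T)) : q ∣ x := by
  obtain ⟨u, hu, w, -, -, hsum⟩ := isWZSum_cons_iff.1 h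
  have hu' : IsUnit u := hu
  rw [← hu'.dvd_mul_left, eq_neg_of_add_eq_zero_left hsum, dvd_neg]
  exact dvd_sum_zipWith_mul hT w

/-- If each term of `L` avoids a divisor common to all later terms of `L ++ K`, then a
unit-weighted zero-sum subsequence of `L ++ K` uses no term of `L`. -/
theorem sublist_of_isWZSum {L K T : List (ZMod n)}
    (hL : ∀ (i : ℕ) (hi : i < L.length), ∃ q : ZMod n, ¬ q ∣ L[i] ∧
      (∀ (j : ℕ) (hj : j < L.length), i < j → q ∣ L[j]) ∧ ∀ y ∈ K, q ∣ y)
    (hT : T.Sublist (L ++ K)) (h : IsWZSum (U n) T) : T.Sublist K := by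
  induction L with
  | nil => simpa using hT
  | cons x L ih =>
    refine ih (fun i hi => ?_) ?_
    · obtain ⟨q, h1, h2, h3⟩ := hL (i + 1) (by simpa using hi)
      refine ⟨q, by simpa using h1, fun j hj hij => ?_, h3⟩
      exact h2 (j + 1) (by simpa using hj) (by omega)
    · rw [List.cons_append, List.sublist_cons_iff] at hT
      rcases hT with hT | ⟨T', rfl, hT'⟩
      · exact hT
      obtain ⟨q, h1, h2, h3⟩ := hL 0 (by simp)
      refine absurd (dvd_of_isWZSum_cons (fun y hy => ?_) h) h1
      rcases List.mem_append.1 (hT'.subset hy) with hyL | hyK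
      · obtain ⟨j, hj, rfl⟩ := List.getElem_of_mem hyL
        exact h2 (j + 1) (by simpa using hj) (by omega)
      · exact h3 y hyK

theorem two_dvd_sub_one_of_isUnit (hn : 2 ∣ n) {u : ZMod n} (hu : IsUnit u) : 2 ∣ u - 1 := by
  obtain ⟨u, rfl⟩ := ZMod.intCast_surjective u
  have h2 : ((2 : ℤ) : ZMod n) ∣ ((u - 1 : ℤ) : ZMod n) ↔ (2 : ℤ) ∣ u - 1 :=
    intCast_dvd_intCast_iff (by exact_mod_cast hn)
  have h2' : ((2 : ℤ) : ZMod n) ∣ ((u : ℤ) : ZMod n) ↔ (2 : ℤ) ∣ u :=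
    intCast_dvd_intCast_iff (by exact_mod_cast hn)
  have hnot : ¬ (2 : ℤ) ∣ u := by
    rw [← h2']
    intro hdvd
    have h1 : ((2 : ℤ) : ZMod n) ∣ ((1 : ℤ) : ZMod n) := by
      rw [Int.cast_one]
      exact (isUnit_of_dvd_unit hdvd hu).dvd
    rw [intCast_dvd_intCast_iff (by exact_mod_cast hn)] at h1
    norm_num at h1
  have := h2.2 (by omega)
  simpa using this

/-- Weighting terms congruent to `2 ^ r` modulo `2 ^ (r + 1)` by units does not affect their sum
modulo `2 ^ (r + 1)`. -/
theorem two_pow_dvd_sum_zipWith_sub (hn : 2 ∣ n) (r : ℕ) {T : List (ZMod n)}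
    (hT : ∀ y ∈ T, (2 : ZMod n) ^ (r + 1) ∣ y - 2 ^ r) {w : List (ZMod n)}
    (hlen : w.length = T.length) (hw : ∀ a ∈ w, a ∈ U n) :
    (2 : ZMod n) ^ (r + 1) ∣ (List.zipWith (· * ·) w T).sum - T.length * 2 ^ r := by
  induction T generalizing w with
  | nil => simp
  | cons y T ih =>
    cases w with
    | nil => simp at hlen
    | cons u w =>
      have hu : 2 ∣ u - 1 := two_dvd_sub_one_of_isUnit hn (hw u (by simp))
      have h1 : (2 : ZMod n) ^ (r + 1) ∣ u * (y - 2 ^ r) + 2 ^ r * (u - 1) :=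
        dvd_add ((hT y (by simp)).mul_left u) (by
          rw [pow_succ]
          exact mul_dvd_mul_left _ hu)
      have h2 := ih (fun z hz => hT z (by simp [hz])) (w := w) (by simpa using hlen)
        (fun a ha => hw a (by simp [ha]))
      convert dvd_add h1 h2 using 1
      simp only [List.zipWith_cons_cons, List.sum_cons, List.length_cons]
      push_cast
      ring

/-- A term divisible by `2 ^ (r + 1)` cannot be completed to a unit-weighted zero-sum sequence by
an odd number of terms of the form `2 ^ r` times an odd number. -/
theorem not_isWZSum_cons_of_odd_length {r : ℕ} (hn : 2 ^ (r + 1) ∣ n) {c : ZMod n}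
    (hc : 2 ^ (r + 1) ∣ c) {T : List (ZMod n)}
    (hT : ∀ y ∈ T, (2 : ZMod n) ^ (r + 1) ∣ y - 2 ^ r) (hodd : Odd T.length) :
    ¬ IsWZSum (U n) (c :: T) := by
  intro h
  obtain ⟨u, -, w, hlen, hw, hsum⟩ := isWZSum_cons_iff.1 h
  have h1 := two_pow_dvd_sum_zipWith_sub ((dvd_pow_self 2 r.succ_ne_zero).trans hn) r hT hlen hw
  rw [eq_neg_of_add_eq_zero_right hsum, ← dvd_neg] at h1
  have h2 : (2 : ZMod n) ^ (r + 1) ∣ T.length * 2 ^ r := by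
    have := dvd_sub h1 (hc.mul_left u)
    convert this using 1
    ring
  have h3 : ((2 ^ (r + 1) : ℤ) : ZMod n) ∣ ((T.length * 2 ^ r : ℤ) : ZMod n) := by
    push_cast
    exact h2
  rw [intCast_dvd_intCast_iff (by exact_mod_cast hn), pow_succ, mul_comm,
    mul_dvd_mul_iff_right (by positivity)] at h3
  obtain ⟨m, hm⟩ := hodd
  omega

end LowerBound

section Extremal

variable {r k n : ℕ} {p : Fin k → ℕ}

theorem odd_prod_of_odd_primes (hp : ∀ i, (p i).Prime) (hpodd : ∀ i, p i ≠ 2)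
    (s : Finset (Fin k)) : Odd (∏ j ∈ s, (p j : ℤ)) :=
  Finset.prod_induction _ _ (fun _ _ => Odd.mul) odd_one fun i _ => by
    exact_mod_cast (hp i).odd_of_ne_two (hpodd i)

theorem natCast_half_eq (hn : n = 2 ^ (r + 1) * ∏ i, p i) :
    ((n / 2 : ℕ) : ZMod n) = ((2 ^ r * ∏ i, (p i : ℤ) : ℤ) : ZMod n) := by
  have : n / 2 = 2 ^ r * ∏ i, p i := by
    rw [hn, pow_succ, mul_right_comm]
    exact Nat.mul_div_cancel _ two_pos
  rw [this]
  push_cast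
  rfl

theorem two_pow_dvd_sub_of_odd (hn : 2 ^ (r + 1) ∣ n) {z : ℤ} (hz : Odd z) :
    (2 : ZMod n) ^ (r + 1) ∣ ((2 ^ r * z : ℤ) : ZMod n) - 2 ^ r := by
  have h : (2 ^ (r + 1) : ℤ) ∣ 2 ^ r * z - 2 ^ r := by
    obtain ⟨m, rfl⟩ := hz
    exact ⟨m, by ring⟩
  simpa using (intCast_dvd_intCast_iff (n := n) (by exact_mod_cast hn)).2 h

/-- The sequence of the main theorem, with its middle block given uniformly in `k`, has no
`U(n)`-weighted zero-sum subsequence of length `n`. -/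
theorem not_hasWZSS (hp : ∀ i, (p i).Prime) (hpodd : ∀ i, p i ≠ 2)
    (hn : n = 2 ^ (r + 1) * ∏ i, p i) (a : Fin r → ℤ) (ha : ∀ i, Odd (a i))
    (c : ℤ) (hc : (2 ^ (r + 1) : ℤ) ∣ c)
    (b : Fin k → ℤ) (hb : ∀ i, Odd (b i) ∧ IsCoprime (b i) (p i : ℤ)) :
    ¬ HasWZSS (U n) ((List.ofFn fun i : Fin r => ((2 ^ (i : ℕ) * a i : ℤ) : ZMod n)) ++
      (c : ZMod n) :: ((List.ofFn fun i : Fin k =>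
        ((2 ^ r * (∏ j ∈ Finset.Iio i, (p j : ℤ)) * b i : ℤ) : ZMod n)) ++
      List.replicate (n - 1) ((n / 2 : ℕ) : ZMod n))) n := by
  rintro ⟨hpos, T, hT, hlen, hsum⟩
  have h2n : 2 ^ (r + 1) ∣ n := ⟨_, hn⟩
  have h2n' : ∀ i ≤ r + 1, (2 ^ i : ℤ) ∣ n := fun i hi =>
    (pow_dvd_pow 2 hi).trans (by exact_mod_cast h2n)
  have htail : ∀ y ∈ (List.ofFn fun i : Fin k =>
        ((2 ^ r * (∏ j ∈ Finset.Iio i, (p j : ℤ)) * b i : ℤ) : ZMod n)) ++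
      List.replicate (n - 1) ((n / 2 : ℕ) : ZMod n),
      ∃ z : ℤ, Odd z ∧ y = ((2 ^ r * z : ℤ) : ZMod n) := by
    intro y hy
    rcases List.mem_append.1 hy with hy | hy
    · obtain ⟨i, rfl⟩ := List.mem_ofFn.1 hy
      exact ⟨_, (odd_prod_of_odd_primes hp hpodd (Finset.Iio i)).mul (hb i).1,
        by rw [mul_assoc]⟩
    · rw [List.eq_of_mem_replicate hy, natCast_half_eq hn]
      exact ⟨_, odd_prod_of_odd_primes hp hpodd _, rfl⟩
  have hT₁ := sublist_of_isWZSum (fun i hi => ?_) hT hsum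
  · have hT₂ : T.Sublist ((List.ofFn fun i : Fin k =>
        ((2 ^ r * (∏ j ∈ Finset.Iio i, (p j : ℤ)) * b i : ℤ) : ZMod n)) ++
        List.replicate (n - 1) ((n / 2 : ℕ) : ZMod n)) := by
      rcases List.sublist_cons_iff.1 hT₁ with h | ⟨T', rfl, hT'⟩
      · exact h
      refine absurd hsum (not_isWZSum_cons_of_odd_length h2n ?_ (fun y hy => ?_) ?_)
      · simpa using (intCast_dvd_intCast_iff (n := n) (h2n' _ le_rfl)).2 hc
      · obtain ⟨z, hz, rfl⟩ := htail y (hT'.subset hy)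
        exact two_pow_dvd_sub_of_odd h2n hz
      · have heven : Even n := (even_iff_two_dvd).2 ((dvd_pow_self 2 r.succ_ne_zero).trans h2n)
        rw [← hlen, List.length_cons, Nat.even_add_one, Nat.not_even_iff_odd] at heven
        exact heven
    have hT₃ := sublist_of_isWZSum (fun i hi => ?_) hT₂ hsum
    · have := hT₃.length_le
      rw [List.length_replicate] at this
      omega
    · rw [List.length_ofFn] at hi
      have hqn : ∏ j ∈ Finset.Iic (⟨i, hi⟩ : Fin k), (p j : ℤ) ∣ n := by
        rw [hn]
        push_cast
        exact (Finset.prod_dvd_prod_of_subset _ _ _ (Finset.subset_univ _)).mul_left _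
      refine ⟨((∏ j ∈ Finset.Iic (⟨i, hi⟩ : Fin k), (p j : ℤ) : ℤ) : ZMod n), ?_, ?_, ?_⟩
      · rw [List.getElem_ofFn, intCast_dvd_intCast_iff hqn, ← Finset.Iio_insert,
          Finset.prod_insert (by simp), mul_comm, mul_comm ((2 : ℤ) ^ r), mul_assoc,
          mul_dvd_mul_iff_left (Finset.prod_ne_zero_iff.2 fun j _ => by
            exact_mod_cast (hp j).ne_zero)]
        intro hdvd
        have hprime : Prime (p ⟨i, hi⟩ : ℤ) := Nat.prime_iff_prime_int.1 (hp _)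
        rcases hprime.dvd_or_dvd hdvd with h | h
        · have h' := hprime.dvd_of_dvd_pow h
          exact hpodd _ ((Nat.prime_dvd_prime_iff_eq (hp _) Nat.prime_two).1 (by exact_mod_cast h'))
        · exact hprime.not_isUnit ((hb ⟨i, hi⟩).2.isUnit_of_dvd' h dvd_rfl)
      · intro j hj hij
        rw [List.length_ofFn] at hj
        rw [List.getElem_ofFn, intCast_dvd_intCast_iff hqn, mul_assoc]
        refine ((Finset.prod_dvd_prod_of_subset _ _ _ fun l hl => ?_).mul_right _).mul_left _
        exact Finset.mem_Iio.2 ((Finset.mem_Iic.1 hl).trans_lt hij)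
      · intro y hy
        rw [List.eq_of_mem_replicate hy, natCast_half_eq hn, intCast_dvd_intCast_iff hqn]
        exact (Finset.prod_dvd_prod_of_subset _ _ _ (Finset.subset_univ _)).mul_left _
  · rw [List.length_ofFn] at hi
    have hdvd : ∀ y : ℤ, ((2 ^ (i + 1) : ℤ) : ZMod n) ∣ (y : ZMod n) ↔ 2 ^ (i + 1) ∣ y :=
      fun y => intCast_dvd_intCast_iff (h2n' _ (by omega))
    refine ⟨((2 ^ (i + 1) : ℤ) : ZMod n), ?_, ?_, ?_⟩
    · rw [List.getElem_ofFn, hdvd, pow_succ, mul_dvd_mul_iff_left (by positivity)]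
      have := ha ⟨i, hi⟩
      rwa [← even_iff_two_dvd, Int.not_even_iff_odd]
    · intro j hj hij
      rw [List.getElem_ofFn, hdvd]
      exact (pow_dvd_pow 2 hij).mul_right _
    · intro y hy
      rcases List.mem_cons.1 hy with rfl | hy
      · exact (hdvd c).2 ((pow_dvd_pow 2 (by omega)).trans hc)
      · obtain ⟨z, -, rfl⟩ := htail y hy
        exact (hdvd _).2 ((pow_dvd_pow 2 (by omega)).mul_right z)

theorem length_primeFactorsList_two_pow_mul_prod (hp : ∀ i, (p i).Prime)
    (hn : n = 2 ^ (r + 1) * ∏ i, p i) : n.primeFactorsList.length = r + 1 + k := by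
  have hprod : ∏ i, p i ≠ 0 := Finset.prod_ne_zero_iff.2 fun i _ => (hp i).ne_zero
  have hcard : ∀ s : Finset (Fin k),
      ArithmeticFunction.cardFactors (∏ i ∈ s, p i) = s.card := by
    intro s
    induction s using Finset.induction_on with
    | empty => simp
    | insert i s hi ih =>
      rw [Finset.prod_insert hi, ArithmeticFunction.cardFactors_mul (hp i).ne_zero
        (Finset.prod_ne_zero_iff.2 fun i _ => (hp i).ne_zero), ih,
        ArithmeticFunction.cardFactors_apply_prime (hp i), Finset.card_insert_of_notMem hi,
        add_comm]
  rw [← ArithmeticFunction.cardFactors_apply, hn,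
    ArithmeticFunction.cardFactors_mul (by positivity) hprod,
    ArithmeticFunction.cardFactors_apply_prime_pow Nat.prime_two, hcard, Finset.card_univ,
    Fintype.card_fin]

theorem hasWZSS_of_sublist {A : Set (ZMod n)} {S S' : List (ZMod n)} {t : ℕ} (h : HasWZSS A S t)
    (hS : S.Sublist S') : HasWZSS A S' t := by
  obtain ⟨ht, T, hT, hsum⟩ := h
  exact ⟨ht, T, hT.trans hS, hsum⟩

/-- For even `n`, a sequence of length `n - 1 + Ω(n)` without `U(n)`-weighted zero-sum subsequence
of length `n` is extremal. -/
theorem isGaoExtremal_of_not_hasWZSS (hn : n ≠ 0) (heven : Even n) {S : List (ZMod n)}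
    (hlen : S.length = n - 1 + n.primeFactorsList.length) (hS : ¬ HasWZSS (U n) S n) :
    IsGaoExtremal n (U n) S := by
  refine ⟨?_, hS⟩
  have hleast : IsLeast {k | 0 < k ∧ ∀ S : List (ZMod n), S.length = k → HasWZSS (U n) S n}
      (n + n.primeFactorsList.length) := by
    refine ⟨⟨by omega, fun S' hS' => hasWZSS_of_length_eq hn heven S' hS'⟩, fun l hl => ?_⟩
    by_contra! hlt
    exact hS (hasWZSS_of_sublist (hl.2 (S.take l) (by rw [List.length_take]; omega))
      (List.take_sublist _ _))
  rw [GaoC, hleast.csInf_eq]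
  omega

end Extremal

end UnitWeights

/-- If `n = 2 ^ (r + 1) * p 1 * ... * p k` with `r ≥ 1` and the `p i` odd primes, the
`a i` odd, `c` divisible by `2 ^ (r + 1)`, and the `b i` odd and coprime to `p i`, then the
sequence `(a 0, 2 * a 1, ..., 2 ^ (r-1) * a (r-1), c, 2 ^ r * b 1, 2 ^ r * p 1 * b 2, ...,
2 ^ r * p 1 * ... * p (k-1) * b k, n/2, ..., n/2)` (with `n - 1` copies of `n / 2`; for
`k = 1` the middle block is just `2 ^ r`) is a `U(n)`-extremal sequence for the Gao
constant. -/
theorem astast_is_gao_extremal (r k n : ℕ) (hr : 1 ≤ r) (hk : 1 ≤ k)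
    (p : Fin k → ℕ) (hp : ∀ i, (p i).Prime) (hpodd : ∀ i, p i ≠ 2)
    (hn : n = 2 ^ (r + 1) * ∏ i, p i)
    (a : Fin r → ℤ) (ha : ∀ i, Odd (a i))
    (c : ℤ) (hc : (2 ^ (r + 1) : ℤ) ∣ c)
    (b : Fin k → ℤ) (hb : ∀ i, Odd (b i) ∧ IsCoprime (b i) ((p i : ℤ)))
    (S : List (ZMod n))
    (hS : (2 ≤ k ∧ S =
          (List.ofFn fun i : Fin r => ((2 ^ (i : ℕ) * a i : ℤ) : ZMod n)) ++
          [((c : ℤ) : ZMod n)] ++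
          (List.ofFn fun i : Fin k =>
            ((2 ^ r * (∏ j ∈ Finset.Iio i, (p j : ℤ)) * b i : ℤ) : ZMod n)) ++
          List.replicate (n - 1) ((n / 2 : ℕ) : ZMod n)) ∨
        (k = 1 ∧ S =
          (List.ofFn fun i : Fin r => ((2 ^ (i : ℕ) * a i : ℤ) : ZMod n)) ++
          [((c : ℤ) : ZMod n)] ++ [((2 ^ r : ℤ) : ZMod n)] ++
          List.replicate (n - 1) ((n / 2 : ℕ) : ZMod n))) :
    S.length = n - 1 + (Nat.primeFactorsList n).length ∧ IsGaoExtremal n (U n) S := by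
  obtain ⟨b', hb', rfl⟩ : ∃ b' : Fin k → ℤ, (∀ i, Odd (b' i) ∧ IsCoprime (b' i) (p i : ℤ)) ∧
      S = (List.ofFn fun i : Fin r => ((2 ^ (i : ℕ) * a i : ℤ) : ZMod n)) ++
        (c : ZMod n) :: ((List.ofFn fun i : Fin k =>
          ((2 ^ r * (∏ j ∈ Finset.Iio i, (p j : ℤ)) * b' i : ℤ) : ZMod n)) ++
        List.replicate (n - 1) ((n / 2 : ℕ) : ZMod n)) := by
    rcases hS with ⟨-, rfl⟩ | ⟨rfl, rfl⟩
    · exact ⟨b, hb, by simp⟩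
    · exact ⟨fun _ => 1, fun i => ⟨odd_one, isCoprime_one_left⟩,
        by simp [show Finset.Iio (0 : Fin 1) = ∅ from rfl]⟩
  have hn0 : n ≠ 0 := by
    rw [hn]
    exact mul_ne_zero (by positivity) (Finset.prod_ne_zero_iff.2 fun i _ => (hp i).ne_zero)
  have heven : Even n := by
    rw [hn, pow_succ']
    simp
  refine (and_iff_left_of_imp fun hlen => UnitWeights.isGaoExtremal_of_not_hasWZSS hn0 heven hlen
    (UnitWeights.not_hasWZSS hp hpodd hn a ha c hc b' hb')).2 ?_
  rw [UnitWeights.length_primeFactorsList_two_pow_mul_prod hp hn]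
  simp only [List.length_append, List.length_cons, List.length_ofFn, List.length_replicate]
  omega
end
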